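/- Let N ≥ 2 and α > 1/2. For every loop U ∈ Lip_α(T → SU(N)) there exists a constant C (depending on α, N and U) and a sequence of SU(N)-valued polynomial loops U_n of degree ≤ n such that ‖U − U_n‖_C ≤ C (n+1)^{−α/(1+α)} for all n ≥ 0. -/

import Mathlib

open scoped Real

attribute [local instance] Matrix.normedAddCommGroup Matrix.normedSpace

/-- Spectral norm (operator 2-norm) of a complex `N × N` matrix. -/
noncomputable def specNorm {N : ℕ} (A : Matrix (Fin N) (Fin N) ℂ) : ℝ :=
  ‖Matrix.toEuclideanCLM (𝕜 := ℂ) A‖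

/-- The special unitary group `SU(N)` as a set of matrices. -/
def SpecialUnitary (N : ℕ) : Set (Matrix (Fin N) (Fin N) ℂ) :=
  {A | A ∈ Matrix.unitaryGroup (Fin N) ℂ ∧ A.det = 1}

/-- The Lie algebra `su(N)`: skew-Hermitian traceless matrices. -/
def SkewTraceless (N : ℕ) : Set (Matrix (Fin N) (Fin N) ℂ) :=
  {A | A.conjTranspose = -A ∧ A.trace = 0}

/-- Uniform (sup) norm of a matrix-valued function, w.r.t. the spectral norm. -/
noncomputable def unifNorm {N : ℕ} (F : ℝ → Matrix (Fin N) (Fin N) ℂ) : ℝ :=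
  ⨆ t, specNorm (F t)

/-- `P` is a polynomial loop of degree `≤ n` with values in the set `G`:
`P t = ∑_{k=-n}^{n} e^{ikt} • C_k` with constant matrix coefficients, and `P t ∈ G`. -/
def IsPolyLoop {N : ℕ} (n : ℕ) (G : Set (Matrix (Fin N) (Fin N) ℂ))
    (P : ℝ → Matrix (Fin N) (Fin N) ℂ) : Prop :=
  (∃ c : ℤ → Matrix (Fin N) (Fin N) ℂ,
    ∀ t : ℝ, P t = ∑ k ∈ Finset.Icc (-(n : ℤ)) (n : ℤ),
      Complex.exp (k * t * Complex.I) • c k) ∧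
  ∀ t : ℝ, P t ∈ G

/-- For `α > 0`, the integer `r` in the decomposition `α = r + β`, `0 < β ≤ 1`. -/
noncomputable def lipR (α : ℝ) : ℕ := ⌈α⌉₊ - 1

/-- For `α > 0`, the exponent `β ∈ (0,1]` in the decomposition `α = r + β`. -/
noncomputable def lipβ (α : ℝ) : ℝ := α - lipR α

/-- Membership in the Lipschitz class `Lip_α`: `F` is `r` times continuously
differentiable and its `r`-th derivative is `β`-Hölder. -/
def MemLip {N : ℕ} (α : ℝ) (F : ℝ → Matrix (Fin N) (Fin N) ℂ) : Prop :=
  ContDiff ℝ (lipR α : ℕ∞) F ∧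
  ∃ C : ℝ, ∀ s t : ℝ,
    specNorm (iteratedDeriv (lipR α) F t - iteratedDeriv (lipR α) F s) ≤ C * |t - s| ^ lipβ α

/-- The `Lip_α` norm: the sup norm plus the smallest Hölder constant of the
`r`-th derivative. -/
noncomputable def lipNorm {N : ℕ} (α : ℝ) (F : ℝ → Matrix (Fin N) (Fin N) ℂ) : ℝ :=
  unifNorm F + sInf {C : ℝ | 0 ≤ C ∧ ∀ s t : ℝ,
    specNorm (iteratedDeriv (lipR α) F t - iteratedDeriv (lipR α) F s) ≤ C * |t - s| ^ lipβ α}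

namespace LoopApprox

open scoped ContDiff

universe u

section LipClass

variable {E F G : Type*} [NormedAddCommGroup E] [NormedSpace ℝ E]
  [NormedAddCommGroup F] [NormedSpace ℝ F] [NormedAddCommGroup G] [NormedSpace ℝ G]

/-- `2π`-periodic functions which are `r` times differentiable with `β`-Hölder `r`-th derivative. -/
def LipClass {E : Type*} [NormedAddCommGroup E] [NormedSpace ℝ E] (β : ℝ) : ℕ → (ℝ → E) → Prop
  | 0, f => Function.Periodic f (2 * π) ∧ ∃ C : ℝ, ∀ s t : ℝ, ‖f t - f s‖ ≤ C * |t - s| ^ β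
  | r + 1, f => Function.Periodic f (2 * π) ∧ Differentiable ℝ f ∧ LipClass β r (deriv f)

variable {β : ℝ} {r : ℕ} {f : ℝ → E}

lemma LipClass.periodic (h : LipClass β r f) : Function.Periodic f (2 * π) := by
  cases r with
  | zero => exact h.1
  | succ r => exact h.1

lemma periodic_deriv (h : Function.Periodic f (2 * π)) :
    Function.Periodic (deriv f) (2 * π) := by
  intro x
  rw [← deriv_comp_add_const]
  congr 1
  exact funext h

lemma continuous_of_holder {E : Type*} [NormedAddCommGroup E] {f : ℝ → E} (hβ : 0 < β) {C : ℝ}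
    (h : ∀ s t : ℝ, ‖f t - f s‖ ≤ C * |t - s| ^ β) : Continuous f := by
  rw [continuous_iff_continuousAt]
  intro s
  rw [ContinuousAt, tendsto_iff_norm_sub_tendsto_zero]
  refine squeeze_zero (fun _ => norm_nonneg _) (fun t => h s t) ?_
  have : Filter.Tendsto (fun t : ℝ => C * |t - s| ^ β) (nhds s) (nhds (C * |s - s| ^ β)) := by
    refine (ContinuousAt.tendsto ?_)
    refine continuousAt_const.mul (ContinuousAt.rpow_const (by fun_prop) (Or.inr hβ.le))
  simpa [Real.zero_rpow hβ.ne'] using this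

lemma LipClass.continuous (hβ : 0 < β) (h : LipClass β r f) : Continuous f := by
  cases r with
  | zero => obtain ⟨_, C, hC⟩ := h; exact continuous_of_holder hβ hC
  | succ r => exact h.2.1.continuous

lemma LipClass.exists_bound (hβ : 0 < β) (h : LipClass β r f) :
    ∃ M : ℝ, 0 ≤ M ∧ ∀ t, ‖f t‖ ≤ M := by
  obtain ⟨M, hM⟩ := (h.periodic.isBounded_of_continuous Real.two_pi_pos.ne'
    (h.continuous hβ)).exists_norm_le
  refine ⟨max M 0, le_max_right _ _, fun t => (hM _ ⟨t, rfl⟩).trans (le_max_left _ _)⟩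

lemma LipClass.exists_lipschitz (hβ : 0 < β) (h : LipClass β (r + 1) f) :
    ∃ C : ℝ, 0 ≤ C ∧ ∀ s t : ℝ, ‖f t - f s‖ ≤ C * |t - s| := by
  obtain ⟨M, hM0, hM⟩ := h.2.2.exists_bound hβ
  refine ⟨M, hM0, fun s t => ?_⟩
  have := Convex.norm_image_sub_le_of_norm_deriv_le (f := f) (s := Set.univ) (x := s) (y := t)
    (fun x _ => h.2.1 x) (fun x _ => hM x) convex_univ trivial trivial
  simpa using this

lemma holder_of_lipschitz_of_bounded {E : Type*} [NormedAddCommGroup E] {f : ℝ → E}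
    (hβ : 0 < β) (hβ1 : β ≤ 1) {C M : ℝ} (hC : 0 ≤ C)
    (h : ∀ s t : ℝ, ‖f t - f s‖ ≤ C * |t - s|) (hM : ∀ t, ‖f t‖ ≤ M) (s t : ℝ) :
    ‖f t - f s‖ ≤ (C + 2 * M) * |t - s| ^ β := by
  have hM0 : 0 ≤ M := (norm_nonneg _).trans (hM 0)
  rcases le_total |t - s| 1 with h1 | h1
  · have h2 : |t - s| ≤ |t - s| ^ β := by
      simpa using Real.rpow_le_rpow_of_exponent_ge_of_imp (abs_nonneg (t - s)) h1 hβ1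
        (fun _ h => absurd h one_ne_zero)
    calc _ ≤ C * |t - s| := h s t
      _ ≤ C * |t - s| ^ β := by gcongr
      _ ≤ _ := by
        have : 0 ≤ |t - s| ^ β := by positivity
        nlinarith
  · have h2 : 1 ≤ |t - s| ^ β := Real.one_le_rpow h1 hβ.le
    calc _ ≤ ‖f t‖ + ‖f s‖ := norm_sub_le _ _
      _ ≤ 2 * M := by linarith [hM t, hM s]
      _ ≤ _ := by nlinarith

lemma LipClass.of_succ (hβ : 0 < β) (hβ1 : β ≤ 1) (h : LipClass β (r + 1) f) :
    LipClass β r f := by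
  induction r generalizing f with
  | zero =>
    obtain ⟨C, hC0, hC⟩ := h.exists_lipschitz hβ
    obtain ⟨M, _, hM⟩ := h.exists_bound hβ
    exact ⟨h.1, _, holder_of_lipschitz_of_bounded hβ hβ1 hC0 hC hM⟩
  | succ r ih => exact ⟨h.1, h.2.1, ih h.2.2⟩

lemma LipClass.const (c : E) : LipClass β r (fun _ : ℝ => c) := by
  induction r generalizing c with
  | zero => exact ⟨fun _ => rfl, 0, by simp⟩
  | succ r ih =>
    refine ⟨fun _ => rfl, differentiable_const c, ?_⟩
    simpa using ih 0

lemma LipClass.add {g : ℝ → E} (hf : LipClass β r f) (hg : LipClass β r g) :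
    LipClass β r (fun t => f t + g t) := by
  induction r generalizing f g with
  | zero =>
    obtain ⟨pf, C, hC⟩ := hf
    obtain ⟨pg, D, hD⟩ := hg
    refine ⟨fun t => by simp [pf t, pg t], C + D, fun s t => ?_⟩
    calc _ = ‖(f t - f s) + (g t - g s)‖ := by rw [add_sub_add_comm]
      _ ≤ _ := (norm_add_le _ _).trans (by rw [add_mul]; exact add_le_add (hC s t) (hD s t))
  | succ r ih =>
    refine ⟨fun t => by simp [hf.1 t, hg.1 t], hf.2.1.add hg.2.1, ?_⟩
    have : deriv (fun t => f t + g t) = fun t => deriv f t + deriv g t :=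
      funext fun t => deriv_fun_add (hf.2.1 t) (hg.2.1 t)
    rw [this]
    exact ih hf.2.2 hg.2.2

lemma LipClass.clm_comp (L : E →L[ℝ] F) (hf : LipClass β r f) :
    LipClass β r (fun t => L (f t)) := by
  induction r generalizing f with
  | zero =>
    obtain ⟨pf, C, hC⟩ := hf
    refine ⟨fun t => by simp [pf t], ‖L‖ * C, fun s t => ?_⟩
    calc _ = ‖L (f t - f s)‖ := by simp
      _ ≤ ‖L‖ * ‖f t - f s‖ := L.le_opNorm _
      _ ≤ ‖L‖ * (C * |t - s| ^ β) := by gcongr; exact hC s t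
      _ = _ := by ring
  | succ r ih =>
    have key (t : ℝ) : HasDerivAt (fun t => L (f t)) (L (deriv f t)) t :=
      L.hasFDerivAt.comp_hasDerivAt t (hf.2.1 t).hasDerivAt
    refine ⟨fun t => by simp [hf.1 t], fun t => (key t).differentiableAt, ?_⟩
    rw [funext fun t => (key t).deriv]
    exact ih hf.2.2

lemma LipClass.bilin (hβ : 0 < β) (hβ1 : β ≤ 1) (B : E →L[ℝ] F →L[ℝ] G) {g : ℝ → F}
    (hf : LipClass β r f) (hg : LipClass β r g) : LipClass β r (fun t => B (f t) (g t)) := by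
  induction r generalizing f g with
  | zero =>
    obtain ⟨Mf, hMf0, hMf⟩ := hf.exists_bound hβ
    obtain ⟨Mg, hMg0, hMg⟩ := hg.exists_bound hβ
    obtain ⟨pf, C, hC⟩ := hf
    obtain ⟨pg, D, hD⟩ := hg
    refine ⟨fun t => by simp [pf t, pg t], ‖B‖ * C * Mg + ‖B‖ * Mf * D, fun s t => ?_⟩
    calc _ = ‖B (f t - f s) (g t) + B (f s) (g t - g s)‖ := by
          congr 1; simp
      _ ≤ ‖B (f t - f s) (g t)‖ + ‖B (f s) (g t - g s)‖ := norm_add_le _ _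
      _ ≤ ‖B‖ * ‖f t - f s‖ * ‖g t‖ + ‖B‖ * ‖f s‖ * ‖g t - g s‖ :=
          add_le_add (B.le_opNorm₂ _ _) (B.le_opNorm₂ _ _)
      _ ≤ ‖B‖ * (C * |t - s| ^ β) * Mg + ‖B‖ * Mf * (D * |t - s| ^ β) := by
          have h1 := hC s t
          have h2 := (norm_nonneg _).trans h1
          gcongr
          exacts [hMg t, hMf s, hD s t]
      _ = _ := by ring
  | succ r ih =>
    have key (t : ℝ) : HasDerivAt (fun t => B (f t) (g t))
        (B (f t) (deriv g t) + B (deriv f t) (g t)) t :=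
      B.hasDerivAt_of_bilinear (fun _ => (hf.2.1 t).hasDerivAt) (fun _ => (hg.2.1 t).hasDerivAt)
    refine ⟨fun t => by simp [hf.1 t, hg.1 t], fun t => (key t).differentiableAt, ?_⟩
    rw [funext fun t => (key t).deriv]
    exact (ih (hf.of_succ hβ hβ1) hg.2.2).add (ih hf.2.2 (hg.of_succ hβ hβ1))

/-- Composition with a function which is smooth near the range preserves `LipClass`. -/
lemma LipClass.comp_contDiffOn {E F : Type u} [NormedAddCommGroup E] [NormedSpace ℝ E]
    [NormedAddCommGroup F] [NormedSpace ℝ F] {f : ℝ → E} (hβ : 0 < β) (hβ1 : β ≤ 1)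
    {Φ : E → F} {Ω : Set E} (hΩ : IsOpen Ω) (hΦ : ContDiffOn ℝ ∞ Φ Ω) (hf : LipClass β r f)
    (hfΩ : ∀ t, f t ∈ Ω) : LipClass β r (fun t => Φ (f t)) := by
  induction r generalizing F with
  | zero =>
    have hloc : LocallyLipschitzOn (Set.range f) Φ := by
      rintro _ ⟨t, rfl⟩
      obtain ⟨K, u, hu, hK⟩ :=
        ((hΦ.contDiffAt (hΩ.mem_nhds (hfΩ t))).of_le (by simp)).exists_lipschitzOnWith
      exact ⟨K, u, mem_nhdsWithin_of_mem_nhds hu, hK⟩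
    obtain ⟨K, hK⟩ := hloc.exists_lipschitzOnWith_of_compact
      (hf.periodic.compact_of_continuous Real.two_pi_pos.ne' (hf.continuous hβ))
    obtain ⟨pf, C, hC⟩ := hf
    refine ⟨fun t => by simp [pf t], K * C, fun s t => ?_⟩
    calc _ ≤ K * ‖f t - f s‖ := by
          simpa [dist_eq_norm] using hK.dist_le_mul _ ⟨t, rfl⟩ _ ⟨s, rfl⟩
      _ ≤ K * (C * |t - s| ^ β) := by gcongr; exact hC s t
      _ = _ := by ring
  | succ r ih =>
    have key (t : ℝ) : HasDerivAt (fun t => Φ (f t)) (fderiv ℝ Φ (f t) (deriv f t)) t :=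
      ((hΦ.differentiableOn (by simp)).differentiableAt
        (hΩ.mem_nhds (hfΩ t))).hasFDerivAt.comp_hasDerivAt t (hf.2.1 t).hasDerivAt
    refine ⟨fun t => by simp [hf.1 t], fun t => (key t).differentiableAt, ?_⟩
    rw [funext fun t => (key t).deriv]
    exact (ih (hΦ.fderiv_of_isOpen hΩ (by simp)) (hf.of_succ hβ hβ1)).bilin hβ hβ1
      (ContinuousLinearMap.id ℝ (E →L[ℝ] F)) hf.2.2

lemma LipClass.sum {ι : Type*} (s : Finset ι) {g : ι → ℝ → E}
    (hg : ∀ i ∈ s, LipClass β r (g i)) : LipClass β r (fun t => ∑ i ∈ s, g i t) := by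
  classical
  induction s using Finset.induction_on with
  | empty => simpa using LipClass.const (β := β) (r := r) (0 : E)
  | insert a s ha ih =>
    simp_rw [Finset.sum_insert ha]
    exact (hg a (Finset.mem_insert_self _ _)).add
      (ih fun i hi => hg i (Finset.mem_insert_of_mem hi))

section Scalar

variable {f g : ℝ → ℂ}

lemma LipClass.mul (hβ : 0 < β) (hβ1 : β ≤ 1) (hf : LipClass β r f) (hg : LipClass β r g) :
    LipClass β r (fun t => f t * g t) :=
  hf.bilin hβ hβ1 (ContinuousLinearMap.mul ℝ ℂ) hg

lemma LipClass.neg (hf : LipClass β r f) : LipClass β r (fun t => -f t) :=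
  hf.clm_comp (-ContinuousLinearMap.id ℝ ℂ)

lemma LipClass.sub (hf : LipClass β r f) (hg : LipClass β r g) :
    LipClass β r (fun t => f t - g t) := by
  simpa only [sub_eq_add_neg] using hf.add hg.neg

lemma LipClass.conj (hf : LipClass β r f) : LipClass β r (fun t => starRingEnd ℂ (f t)) :=
  hf.clm_comp (Complex.conjCLE : ℂ →L[ℝ] ℂ)

lemma LipClass.inv (hβ : 0 < β) (hβ1 : β ≤ 1) (hf : LipClass β r f) (h0 : ∀ t, f t ≠ 0) :
    LipClass β r (fun t => (f t)⁻¹) :=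
  hf.comp_contDiffOn hβ hβ1 (Φ := fun z : ℂ => z⁻¹) (Ω := {0}ᶜ) isOpen_compl_singleton
    (fun _ hz => (contDiffAt_inv ℝ hz).contDiffWithinAt) h0

/-- A function into `ℂ` which is Hölder of exponent more than `1/2` does not cover the disc. -/
lemma LipClass.exists_notMem_range (hβ : 0 < β) (hα : 1 / 2 < r + β) (hf : LipClass β r f) :
    ∃ z : ℂ, ‖z‖ < 1 ∧ ∀ t, f t ≠ z := by
  obtain ⟨γ, hγ, C, hC0, hC⟩ : ∃ γ : ℝ, 1 / 2 < γ ∧ ∃ C : ℝ, 0 ≤ C ∧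
      ∀ s t, ‖f t - f s‖ ≤ C * |t - s| ^ γ := by
    cases r with
    | zero =>
      obtain ⟨_, C, hC⟩ := hf
      refine ⟨β, by simpa using hα, C, ?_, hC⟩
      simpa using (norm_nonneg _).trans (hC 0 1)
    | succ r =>
      obtain ⟨C, hC0, hC⟩ := hf.exists_lipschitz hβ
      exact ⟨1, by norm_num, C, hC0, by simpa using hC⟩
  lift γ to NNReal using by linarith
  lift C to NNReal using hC0
  have hγ2 : (1 / 2 : NNReal) < γ := by exact_mod_cast hγ
  have hH : HolderWith C γ f := by
    intro s t
    have h := hC t s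
    rw [edist_nndist, edist_nndist, ← ENNReal.coe_rpow_of_nonneg _ (NNReal.coe_nonneg γ), ← ENNReal.coe_mul,
      ENNReal.coe_le_coe, ← NNReal.coe_le_coe]
    simpa [dist_eq_norm, Real.dist_eq] using h
  have hγ0 : 0 < γ := lt_trans (by norm_num) hγ2
  by_contra! hcon
  have hball : Metric.ball (0 : ℂ) 1 ⊆ Set.range f := fun z hz => by
    obtain ⟨t, ht⟩ := hcon z (by simpa using hz)
    exact ⟨t, ht⟩
  have h2 : (2 : ENNReal) ≤ dimH (Set.range f) := by
    refine le_trans (le_of_eq ?_) (dimH_mono hball)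
    rw [Real.dimH_of_nonempty_interior]
    · simp
    · rw [Metric.isOpen_ball.interior_eq]
      exact ⟨0, by simp⟩
  have h1 := hH.dimH_range_le hγ0
  rw [Real.dimH_univ] at h1
  have h3 := h2.trans h1
  rw [one_div, ← ENNReal.coe_inv hγ0.ne'] at h3
  have h4 : (2 : NNReal) ≤ γ⁻¹ := by exact_mod_cast h3
  have h5 : γ⁻¹ < 2 := by
    rw [inv_lt_comm₀ hγ0 two_pos]
    simpa using hγ2
  exact absurd h4 (not_le.2 h5)

end Scalar

end LipClass

end LoopApprox

namespace LoopApprox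

section TrigPoly

variable {E : Type*} [AddCommGroup E] [Module ℂ E]

/-- Trigonometric polynomials of degree at most `d` with coefficients in a complex vector space. -/
def IsTrigPoly (d : ℕ) (P : ℝ → E) : Prop :=
  ∃ c : ℤ → E, ∀ t : ℝ, P t = ∑ k ∈ Finset.Icc (-(d : ℤ)) (d : ℤ),
    Complex.exp (k * t * Complex.I) • c k

lemma IsTrigPoly.add {d : ℕ} {P Q : ℝ → E} (hP : IsTrigPoly d P) (hQ : IsTrigPoly d Q) :
    IsTrigPoly d (fun t => P t + Q t) := by
  obtain ⟨c, hc⟩ := hP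
  obtain ⟨c', hc'⟩ := hQ
  exact ⟨fun k => c k + c' k, fun t => by simp [hc, hc', Finset.sum_add_distrib]⟩

lemma isTrigPoly_zero (d : ℕ) : IsTrigPoly d (fun _ => (0 : E)) :=
  ⟨fun _ => 0, fun t => by simp⟩

lemma IsTrigPoly.sum {ι : Type*} {d : ℕ} (s : Finset ι) {P : ι → ℝ → E}
    (h : ∀ i ∈ s, IsTrigPoly d (P i)) : IsTrigPoly d (fun t => ∑ i ∈ s, P i t) := by
  classical
  induction s using Finset.induction_on with
  | empty => simpa using isTrigPoly_zero d
  | insert a s ha ih =>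
    simp_rw [Finset.sum_insert ha]
    exact (h a (Finset.mem_insert_self _ _)).add
      (ih fun i hi => h i (Finset.mem_insert_of_mem hi))

lemma isTrigPoly_monomial {d : ℕ} {k : ℤ} (hk : |k| ≤ d) (x : E) :
    IsTrigPoly d (fun t => Complex.exp (k * t * Complex.I) • x) := by
  classical
  refine ⟨Pi.single k x, fun t => ?_⟩
  rw [Finset.sum_eq_single k]
  · simp
  · intro j _ hj
    simp [Pi.single_eq_of_ne hj]
  · intro h
    exact absurd (Finset.mem_Icc.2 (abs_le.1 hk)) h

lemma isTrigPoly_const (d : ℕ) (x : E) : IsTrigPoly d (fun _ => x) := by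
  simpa using isTrigPoly_monomial (d := d) (k := 0) (by simp) x

lemma IsTrigPoly.mono {d d' : ℕ} (h : d ≤ d') {P : ℝ → E} (hP : IsTrigPoly d P) :
    IsTrigPoly d' P := by
  obtain ⟨c, hc⟩ := hP
  rw [funext hc]
  refine IsTrigPoly.sum _ fun k hk => isTrigPoly_monomial ?_ _
  rw [Finset.mem_Icc] at hk
  exact (abs_le.2 hk).trans (by exact_mod_cast h)

lemma IsTrigPoly.mul {A : Type*} [Ring A] [Algebra ℂ A] {d d' : ℕ} {P Q : ℝ → A}
    (hP : IsTrigPoly d P) (hQ : IsTrigPoly d' Q) :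
    IsTrigPoly (d + d') (fun t => P t * Q t) := by
  obtain ⟨c, hc⟩ := hP
  obtain ⟨c', hc'⟩ := hQ
  have : (fun t => P t * Q t) = fun t : ℝ => ∑ k ∈ Finset.Icc (-(d : ℤ)) (d : ℤ),
      ∑ l ∈ Finset.Icc (-(d' : ℤ)) (d' : ℤ),
        Complex.exp (((k + l : ℤ) : ℂ) * t * Complex.I) • (c k * c' l) := by
    funext t
    rw [hc, hc', Finset.sum_mul_sum]
    refine Finset.sum_congr rfl fun k _ => Finset.sum_congr rfl fun l _ => ?_
    rw [smul_mul_smul_comm, ← Complex.exp_add]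
    congr 2
    push_cast
    ring
  rw [this]
  refine IsTrigPoly.sum _ fun k hk => IsTrigPoly.sum _ fun l hl => isTrigPoly_monomial ?_ _
  rw [Finset.mem_Icc] at hk hl
  rw [abs_le]
  push_cast
  constructor <;> linarith [hk.1, hk.2, hl.1, hl.2]

end TrigPoly

section Parseval

lemma discrete_parseval {M : ℕ} {ω : ℂ} (hω : IsPrimitiveRoot ω M) (hM : 0 < M) (b : ℕ → ℂ) :
    ∑ l ∈ Finset.range M, ‖∑ p ∈ Finset.range M, b p * (ω ^ l) ^ p‖ ^ 2 =
      M * ∑ p ∈ Finset.range M, ‖b p‖ ^ 2 := by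
  have hnorm : ‖ω‖ = 1 := hω.norm'_eq_one hM.ne'
  have hω0 : ω ≠ 0 := hω.ne_zero hM.ne'
  have hconj : starRingEnd ℂ ω = ω⁻¹ := by
    rw [Complex.inv_def, Complex.normSq_eq_norm_sq, hnorm]; simp
  have horth (p q : ℕ) (hp : p ∈ Finset.range M) (hq : q ∈ Finset.range M) :
      ∑ l ∈ Finset.range M, (ω ^ l) ^ p * (ω⁻¹ ^ l) ^ q = if p = q then (M : ℂ) else 0 := by
    have h1 (l : ℕ) : (ω ^ l) ^ p * (ω⁻¹ ^ l) ^ q = (ω ^ p * ω⁻¹ ^ q) ^ l := by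
      rw [mul_pow, ← pow_mul, ← pow_mul, ← pow_mul, ← pow_mul, mul_comm l p, mul_comm l q]
    simp_rw [h1]
    split_ifs with h
    · subst h
      rw [← mul_pow, mul_inv_cancel₀ hω0]
      simp
    · have hne : ω ^ p * ω⁻¹ ^ q ≠ 1 := by
        intro h2
        rw [inv_pow, mul_inv_eq_one₀ (pow_ne_zero _ hω0)] at h2
        exact h (hω.pow_inj (Finset.mem_range.1 hp) (Finset.mem_range.1 hq) h2)
      rw [geom_sum_eq hne]
      rw [mul_pow, ← pow_mul, ← pow_mul, mul_comm p, mul_comm q, pow_mul, pow_mul, inv_pow,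
        hω.pow_eq_one]
      simp
  have hC : ∀ z : ℂ, ((‖z‖ ^ 2 : ℝ) : ℂ) = z * starRingEnd ℂ z := fun z => by
    rw [Complex.mul_conj, Complex.normSq_eq_norm_sq]
  have key : ((∑ l ∈ Finset.range M, ‖∑ p ∈ Finset.range M, b p * (ω ^ l) ^ p‖ ^ 2 : ℝ) : ℂ) =
      ((M * ∑ p ∈ Finset.range M, ‖b p‖ ^ 2 : ℝ) : ℂ) := by
    push_cast [← Complex.ofReal_pow]
    simp_rw [hC, map_sum, Finset.sum_mul_sum, map_mul, map_pow, hconj]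
    rw [Finset.sum_comm, Finset.mul_sum]
    refine Finset.sum_congr rfl fun p hp => ?_
    rw [Finset.sum_comm]
    rw [Finset.sum_congr rfl (g := fun q =>
      b p * starRingEnd ℂ (b q) * if p = q then (M : ℂ) else 0)]
    · rw [Finset.sum_eq_single p]
      · simp; ring
      · intro q _ hq
        simp [hq.symm]
      · intro h; exact absurd hp h
    · intro q hq
      rw [← horth p q hp hq, Finset.mul_sum]
      refine Finset.sum_congr rfl fun l _ => ?_
      ring
  exact_mod_cast key

lemma sum_norm_coeff_le {d : ℕ} {c : ℤ → ℂ} {ε : ℝ}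
    (h : ∀ t : ℝ, ‖∑ k ∈ Finset.Icc (-(d : ℤ)) (d : ℤ),
      Complex.exp (k * t * Complex.I) • c k‖ ≤ ε) :
    ∑ k ∈ Finset.Icc (-(d : ℤ)) (d : ℤ), ‖c k‖ ≤ √(2 * d + 1) * ε := by
  have hε : 0 ≤ ε := (norm_nonneg _).trans (h 0)
  have reindex {X : Type} [AddCommMonoid X] (φ : ℤ → X) :
      ∑ k ∈ Finset.Icc (-(d : ℤ)) (d : ℤ), φ k =
        ∑ p ∈ Finset.range (2 * d + 1), φ ((p : ℤ) - d) := by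
    refine Finset.sum_nbij' (fun k => (k + d).toNat) (fun p => (p : ℤ) - d) ?_ ?_ ?_ ?_ ?_
    · intro k hk; simp only [Finset.mem_Icc, Finset.mem_range] at *; omega
    · intro k hk; simp only [Finset.mem_Icc, Finset.mem_range] at *; omega
    · intro k hk; simp only [Finset.mem_Icc] at *; omega
    · intro k hk; omega
    · intro k hk
      simp only [Finset.mem_Icc] at *
      congr 1; omega
  set M := 2 * d + 1 with hM
  have hM0 : M ≠ 0 := by omega
  set ω := Complex.exp (2 * π * Complex.I / M) with hω
  have hprim : IsPrimitiveRoot ω M := Complex.isPrimitiveRoot_exp M hM0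
  have hval (l : ℕ) : ‖∑ p ∈ Finset.range M, c ((p : ℤ) - d) * (ω ^ l) ^ p‖ ≤ ε := by
    have h1 := h (2 * π * l / M)
    rw [reindex] at h1
    have h2 : ∑ p ∈ Finset.range M, Complex.exp ((((p : ℤ) - d : ℤ) : ℂ) *
          ((2 * π * l / M : ℝ) : ℂ) * Complex.I) • c ((p : ℤ) - d) =
        Complex.exp (((-(d : ℝ) * (2 * π * l / M) : ℝ) : ℂ) * Complex.I) *
          ∑ p ∈ Finset.range M, c ((p : ℤ) - d) * (ω ^ l) ^ p := by
      rw [Finset.mul_sum]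
      refine Finset.sum_congr rfl fun p _ => ?_
      rw [hω, ← Complex.exp_nat_mul, ← Complex.exp_nat_mul, smul_eq_mul, mul_left_comm,
        ← Complex.exp_add, mul_comm]
      congr 2
      push_cast
      ring
    rw [h2, norm_mul, Complex.norm_exp_ofReal_mul_I, one_mul] at h1
    exact h1
  have hpars := discrete_parseval hprim (Nat.pos_of_ne_zero hM0) (fun p => c ((p : ℤ) - d))
  have hsq : ∑ p ∈ Finset.range M, ‖c ((p : ℤ) - d)‖ ^ 2 ≤ ε ^ 2 := by
    have h1 : (M : ℝ) * ∑ p ∈ Finset.range M, ‖c ((p : ℤ) - d)‖ ^ 2 ≤ M * ε ^ 2 := by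
      rw [← hpars]
      calc _ ≤ ∑ l ∈ Finset.range M, ε ^ 2 := by
            refine Finset.sum_le_sum fun l _ => ?_
            have := hval l
            gcongr
        _ = _ := by simp
    exact le_of_mul_le_mul_left h1 (by positivity)
  rw [reindex]
  have hcs := sq_sum_le_card_mul_sum_sq (s := Finset.range M)
    (f := fun p : ℕ => ‖c ((p : ℤ) - d)‖)
  rw [Finset.card_range] at hcs
  calc _ ≤ √((2 * d + 1) * ε ^ 2) := by
        refine Real.le_sqrt_of_sq_le (hcs.trans ?_)
        rw [hM]
        push_cast
        gcongr
    _ = _ := by rw [Real.sqrt_mul (by positivity), Real.sqrt_sq hε]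

end Parseval

end LoopApprox

namespace LoopApprox

section Jackson

lemma rpow_le_one_add_sq {x β : ℝ} (hx : 0 ≤ x) (hβ : 0 < β) (hβ1 : β ≤ 1) :
    x ^ β ≤ 1 + x ^ 2 := by
  rcases le_total x 1 with h | h
  · have := Real.rpow_le_one hx h hβ.le
    nlinarith [sq_nonneg x]
  · have := Real.rpow_le_rpow_of_exponent_le h (show β ≤ 2 by linarith)
    rw [Real.rpow_two] at this
    linarith

lemma sq_le_one_sub_cos {y : ℝ} (hy : |y| ≤ π) : y ^ 2 ≤ π ^ 2 / 2 * (1 - Real.cos y) := by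
  have h := Real.cos_le_one_sub_mul_cos_sq hy
  have h2 : 2 / π ^ 2 * y ^ 2 ≤ 1 - Real.cos y := by linarith
  calc y ^ 2 = π ^ 2 / 2 * (2 / π ^ 2 * y ^ 2) := by field_simp
    _ ≤ _ := by gcongr

lemma periodic_holder_le {E : Type*} [NormedAddCommGroup E] {f : ℝ → E} {β L n : ℝ}
    (hβ : 0 < β) (hβ1 : β ≤ 1) (hL : 0 ≤ L) (hn : 0 < n)
    (hf : Function.Periodic f (2 * π)) (h : ∀ s t : ℝ, ‖f t - f s‖ ≤ L * |t - s| ^ β) (s t : ℝ) :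
    ‖f t - f s‖ ≤ L * n ^ (-β) * (1 + n ^ 2 * (π ^ 2 / 2) * (1 - Real.cos (t - s))) := by
  set k : ℤ := round ((t - s) / (2 * π))
  set y := t - (s + k * (2 * π)) with hy
  have hyabs : |y| ≤ π := by
    have h1 := abs_sub_round ((t - s) / (2 * π))
    have h2 : y = ((t - s) / (2 * π) - k) * (2 * π) := by
      rw [hy]; field_simp; ring
    rw [h2, abs_mul, abs_of_pos Real.two_pi_pos]
    nlinarith [Real.pi_pos]
  have hcos : Real.cos (t - s) = Real.cos y := by
    rw [hy, ← sub_sub, Real.cos_sub_int_mul_two_pi]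
  have hfs : f s = f (s + k * (2 * π)) := (hf.int_mul k s).symm
  have hyβ : |y| ^ β ≤ n ^ (-β) * (1 + n ^ 2 * (π ^ 2 / 2) * (1 - Real.cos y)) := by
    have h1 : |y| ^ β = n ^ (-β) * (n * |y|) ^ β := by
      rw [Real.mul_rpow hn.le (abs_nonneg y), ← mul_assoc, ← Real.rpow_add hn]
      simp
    rw [h1]
    gcongr
    refine (rpow_le_one_add_sq (by positivity) hβ hβ1).trans ?_
    rw [mul_pow, sq_abs]
    have := sq_le_one_sub_cos hyabs
    have h3 : n ^ 2 * y ^ 2 ≤ n ^ 2 * (π ^ 2 / 2 * (1 - Real.cos y)) := by gcongr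
    linarith
  rw [hfs, hcos, mul_assoc]
  exact (h _ _).trans (by gcongr)

lemma sum_kernel_coeff_sq (n : ℕ) :
    (30 : ℝ) * ∑ p ∈ Finset.range (n + 1), ((p : ℝ) * (n - p)) ^ 2 = n * ((n : ℝ) ^ 4 - 1) := by
  have h (x : ℝ) (m : ℕ) : (30 : ℝ) * ∑ p ∈ Finset.range m, ((p : ℝ) * (x - p)) ^ 2 =
      5 * x ^ 2 * ((m - 1) * m * (2 * m - 1)) - 15 * x * (m * (m - 1)) ^ 2 +
        (m - 1) * m * (2 * m - 1) * (3 * m ^ 2 - 3 * m - 1) := by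
    induction m with
    | zero => simp
    | succ m ih =>
      rw [Finset.sum_range_succ, mul_add, ih]
      push_cast
      ring
  rw [h]
  push_cast
  ring

lemma sum_kernel_diff_sq (n : ℕ) :
    (3 : ℝ) * ∑ p ∈ Finset.range n, ((n : ℝ) - 1 - 2 * p) ^ 2 = n * ((n : ℝ) ^ 2 - 1) := by
  have h (x : ℝ) (m : ℕ) : (3 : ℝ) * ∑ p ∈ Finset.range m, (x - 1 - 2 * p) ^ 2 =
      3 * m * (x - 1) ^ 2 - 6 * (x - 1) * (m * (m - 1)) + 2 * ((m - 1) * m * (2 * m - 1)) := by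
    induction m with
    | zero => simp
    | succ m ih =>
      rw [Finset.sum_range_succ, mul_add, ih]
      push_cast
      ring
  rw [h]
  ring

lemma sum_kernel_mul_one_sub (n m : ℕ) (z : ℂ) :
    (∑ p ∈ Finset.range (m + 1), ((p : ℂ) * (n - p)) * z ^ p) * (1 - z) =
      (∑ p ∈ Finset.range m, (((n : ℂ) - 1 - 2 * p) * z) * z ^ p) -
        (m : ℂ) * (n - m) * z ^ (m + 1) := by
  induction m with
  | zero => simp
  | succ m ih =>
    rw [Finset.sum_range_succ, add_mul, ih, Finset.sum_range_succ]
    push_cast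
    ring

lemma norm_one_sub_exp_sq (y : ℝ) :
    ‖1 - Complex.exp (y * Complex.I)‖ ^ 2 = 2 * (1 - Real.cos y) := by
  rw [Complex.sq_norm, Complex.exp_mul_I, Complex.normSq_apply]
  simp only [Complex.sub_re, Complex.one_re, Complex.add_re, Complex.cos_ofReal_re, Complex.mul_re,
    Complex.sin_ofReal_re, Complex.sin_ofReal_im, Complex.I_re, Complex.I_im, Complex.sub_im,
    Complex.one_im, Complex.add_im, Complex.cos_ofReal_im, Complex.mul_im]
  nlinarith [Real.sin_sq_add_cos_sq y]

/-- The generating polynomial of the Jackson-type kernel. -/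
noncomputable def kernelPoly (n : ℕ) (z : ℂ) : ℂ :=
  ∑ p ∈ Finset.range n, ((p : ℂ) * (n - p)) * z ^ p

lemma kernelPoly_eq (n : ℕ) (z : ℂ) :
    kernelPoly n z = ∑ p ∈ Finset.range (n + 1), ((p : ℂ) * (n - p)) * z ^ p := by
  simp [kernelPoly, Finset.sum_range_succ]

lemma isTrigPoly_kernel (n : ℕ) (x : ℝ) (a : ℂ) :
    IsTrigPoly (n - 1)
      (fun t : ℝ => ((‖kernelPoly n (Complex.exp ((t - x : ℝ) * Complex.I))‖ ^ 2 : ℝ) : ℂ) * a) := by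
  have h : (fun t : ℝ =>
      ((‖kernelPoly n (Complex.exp ((t - x : ℝ) * Complex.I))‖ ^ 2 : ℝ) : ℂ) * a) =
      fun t : ℝ => ∑ p ∈ Finset.range n, ∑ q ∈ Finset.range n,
        Complex.exp ((((p : ℤ) - (q : ℤ) : ℤ) : ℂ) * t * Complex.I) •
          (((p : ℂ) * (n - p)) * ((q : ℂ) * (n - q)) *
            Complex.exp (-(((p : ℂ) - q) * x * Complex.I)) * a) := by
    funext t
    rw [← Complex.normSq_eq_norm_sq, ← Complex.mul_conj, kernelPoly, map_sum, Finset.sum_mul_sum,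
      Finset.sum_mul]
    refine Finset.sum_congr rfl fun p _ => ?_
    rw [Finset.sum_mul]
    refine Finset.sum_congr rfl fun q _ => ?_
    have h1 : Complex.exp ((t - x : ℝ) * Complex.I) ^ p *
        starRingEnd ℂ (Complex.exp ((t - x : ℝ) * Complex.I)) ^ q =
        Complex.exp ((((p : ℤ) - (q : ℤ) : ℤ) : ℂ) * t * Complex.I) *
          Complex.exp (-(((p : ℂ) - q) * x * Complex.I)) := by
      rw [← Complex.exp_conj, ← Complex.exp_nat_mul, ← Complex.exp_nat_mul, ← Complex.exp_add,
        ← Complex.exp_add]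
      congr 1
      simp only [map_mul, Complex.conj_ofReal, Complex.conj_I]
      push_cast
      ring
    simp only [map_mul, map_sub, map_natCast, map_pow, smul_eq_mul]
    linear_combination ((p : ℂ) * (n - p)) * ((q : ℂ) * (n - q)) * a * h1
  rw [h]
  refine IsTrigPoly.sum _ fun p hp => IsTrigPoly.sum _ fun q hq => isTrigPoly_monomial ?_ _
  rw [Finset.mem_range] at hp hq
  rw [abs_le]
  omega

lemma sum_kernel_nodes (n : ℕ) (t : ℝ) :
    ∑ l ∈ Finset.range (n + 1),
      ‖kernelPoly n (Complex.exp ((t - 2 * π * l / (n + 1) : ℝ) * Complex.I))‖ ^ 2 =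
      ((n : ℝ) + 1) * ∑ p ∈ Finset.range (n + 1), ((p : ℝ) * (n - p)) ^ 2 ∧
    ∑ l ∈ Finset.range (n + 1),
      ‖kernelPoly n (Complex.exp ((t - 2 * π * l / (n + 1) : ℝ) * Complex.I))‖ ^ 2 *
        (1 - Real.cos (t - 2 * π * l / (n + 1))) =
      ((n : ℝ) + 1) / 2 * ∑ p ∈ Finset.range n, ((n : ℝ) - 1 - 2 * p) ^ 2 := by
  set ω := (Complex.exp (2 * π * Complex.I / (n + 1 : ℕ)))⁻¹ with hω
  have hprim : IsPrimitiveRoot ω (n + 1) := (Complex.isPrimitiveRoot_exp _ (Nat.succ_ne_zero n)).inv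
  have hz (l : ℕ) : Complex.exp ((t - 2 * π * l / (n + 1) : ℝ) * Complex.I) =
      Complex.exp (t * Complex.I) * ω ^ l := by
    rw [hω, ← Complex.exp_neg, ← Complex.exp_nat_mul, ← Complex.exp_add]
    congr 1
    push_cast
    ring
  have hn1 (p : ℕ) : ‖Complex.exp (t * Complex.I) ^ p‖ = 1 := by
    rw [norm_pow, Complex.norm_exp_ofReal_mul_I, one_pow]
  constructor
  · have h := discrete_parseval hprim (Nat.succ_pos n)
      (fun p => ((p : ℂ) * (n - p)) * Complex.exp (t * Complex.I) ^ p)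
    push_cast at h
    convert h using 2
    · rename_i l _
      rw [hz, kernelPoly_eq]
      congr 2
      refine Finset.sum_congr rfl fun p _ => ?_
      rw [mul_pow]; ring
    · refine Finset.sum_congr rfl fun p _ => ?_
      rw [norm_mul, hn1, mul_one]
      rw [show (p : ℂ) * (n - p) = (((p : ℝ) * (n - p) : ℝ) : ℂ) by push_cast; ring,
        Complex.norm_real, Real.norm_eq_abs, sq_abs]
  · have h := discrete_parseval hprim (Nat.succ_pos n)
      (fun p => if p < n then ((n : ℂ) - 1 - 2 * p) * Complex.exp (t * Complex.I) ^ p else 0)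
    push_cast at h
    have h2 : ∑ p ∈ Finset.range (n + 1), ‖if p < n then
        ((n : ℂ) - 1 - 2 * p) * Complex.exp (t * Complex.I) ^ p else 0‖ ^ 2 =
        ∑ p ∈ Finset.range n, ((n : ℝ) - 1 - 2 * p) ^ 2 := by
      rw [Finset.sum_range_succ]
      simp only [lt_irrefl, if_false, norm_zero, ne_eq, OfNat.ofNat_ne_zero, not_false_eq_true,
        zero_pow, add_zero]
      refine Finset.sum_congr rfl fun p hp => ?_
      rw [if_pos (Finset.mem_range.1 hp), norm_mul, hn1, mul_one,
        show (n : ℂ) - 1 - 2 * p = (((n : ℝ) - 1 - 2 * p : ℝ) : ℂ) by push_cast; ring,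
        Complex.norm_real, Real.norm_eq_abs, sq_abs]
    rw [h2] at h
    rw [div_mul_eq_mul_div, ← h, Finset.sum_div]
    refine Finset.sum_congr rfl fun l _ => ?_
    have h3 := norm_one_sub_exp_sq (t - 2 * π * l / (n + 1))
    rw [show 1 - Real.cos (t - 2 * π * l / (n + 1)) =
      ‖1 - Complex.exp ((t - 2 * π * l / (n + 1) : ℝ) * Complex.I)‖ ^ 2 / 2 by rw [h3]; ring,
      ← mul_div_assoc, ← mul_pow, ← norm_mul, kernelPoly_eq, sum_kernel_mul_one_sub, hz]
    congr 2
    rw [Finset.sum_range_succ]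
    simp only [sub_self, mul_zero, zero_mul, sub_zero, lt_irrefl, if_false, add_zero]
    have h4 : ‖Complex.exp (t * Complex.I) * ω ^ l‖ = 1 := by
      rw [← hz, Complex.norm_exp_ofReal_mul_I]
    calc _ = ‖(Complex.exp (t * Complex.I) * ω ^ l) * ∑ p ∈ Finset.range n,
          (if p < n then ((n : ℂ) - 1 - 2 * p) * Complex.exp (t * Complex.I) ^ p else 0) *
            (ω ^ l) ^ p‖ := by
          rw [Finset.mul_sum]
          congr 1
          refine Finset.sum_congr rfl fun p hp => ?_
          rw [if_pos (Finset.mem_range.1 hp)]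
          ring
      _ = _ := by rw [norm_mul, h4, one_mul]

lemma exists_isTrigPoly_of_holder {β : ℝ} (hβ : 0 < β) (hβ1 : β ≤ 1) {f : ℝ → ℂ} {L : ℝ}
    (hL : 0 ≤ L) (hf : Function.Periodic f (2 * π))
    (h : ∀ s t : ℝ, ‖f t - f s‖ ≤ L * |t - s| ^ β) {K : ℕ} (hK : 1 ≤ K) :
    ∃ T : ℝ → ℂ, IsTrigPoly K T ∧
      ∀ t, ‖f t - T t‖ ≤ (1 + 5 * π ^ 2 / 2) * L * (K : ℝ) ^ (-β) := by
  set n := K + 1 with hn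
  set A : ℝ := ∑ p ∈ Finset.range (n + 1), ((p : ℝ) * (n - p)) ^ 2 with hA
  have hA30 := sum_kernel_coeff_sq n
  have hD3 := sum_kernel_diff_sq n
  rw [← hA] at hA30
  set D : ℝ := ∑ p ∈ Finset.range n, ((n : ℝ) - 1 - 2 * p) ^ 2 with hD
  have hn2 : (2 : ℝ) ≤ n := by rw [hn]; push_cast; exact_mod_cast Nat.succ_le_succ hK
  have hn4 : (1 : ℝ) < (n : ℝ) ^ 4 := one_lt_pow₀ (by linarith) (by norm_num)
  have hApos : 0 < A := by
    have : 0 < (n : ℝ) * ((n : ℝ) ^ 4 - 1) := mul_pos (by linarith) (by linarith)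
    linarith
  have hDA : (n : ℝ) ^ 2 * D ≤ 10 * A := by
    have h1 : ((n : ℝ) ^ 2 + 1) * D = 10 * A := by
      have : 3 * (((n : ℝ) ^ 2 + 1) * D) = 30 * A := by
        rw [hA30, mul_left_comm, hD3]; ring
      linarith
    have h2 : 0 ≤ D := Finset.sum_nonneg fun _ _ => sq_nonneg _
    linarith
  set x : ℕ → ℝ := fun l => 2 * π * l / (n + 1) with hx
  set w : ℕ → ℝ → ℝ := fun l t =>
    ‖kernelPoly n (Complex.exp ((t - x l : ℝ) * Complex.I))‖ ^ 2 with hw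
  have hw0 (l : ℕ) (t : ℝ) : 0 ≤ w l t := by positivity
  have hsum (t : ℝ) := sum_kernel_nodes n t
  set B : ℝ := (n + 1) * A with hB
  have hBpos : 0 < B := by positivity
  refine ⟨fun t => ∑ l ∈ Finset.range (n + 1), (w l t : ℂ) * (f (x l) / B), ?_, fun t => ?_⟩
  · exact IsTrigPoly.sum _ fun l _ => isTrigPoly_kernel n (x l) _
  · obtain ⟨h1, h2⟩ := hsum t
    have h3 : f t - ∑ l ∈ Finset.range (n + 1), (w l t : ℂ) * (f (x l) / B) =
        (∑ l ∈ Finset.range (n + 1), (w l t : ℂ) * (f t - f (x l))) / B := by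
      have h4 : ((∑ l ∈ Finset.range (n + 1), w l t : ℝ) : ℂ) = (B : ℂ) := congrArg _ h1
      push_cast at h4
      have hB0 : (B : ℂ) ≠ 0 := by exact_mod_cast hBpos.ne'
      simp_rw [mul_sub, Finset.sum_sub_distrib, ← Finset.sum_mul, h4, ← mul_div_assoc,
        ← Finset.sum_div]
      field_simp
    rw [h3, norm_div, Complex.norm_real, Real.norm_of_nonneg hBpos.le, div_le_iff₀ hBpos]
    have hnpos : (0 : ℝ) < n := by linarith
    have hKpos : (0 : ℝ) < K := by exact_mod_cast hK
    have hnK : (n : ℝ) ^ (-β) ≤ (K : ℝ) ^ (-β) :=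
      Real.rpow_le_rpow_of_nonpos hKpos (by rw [hn]; push_cast; linarith) (by linarith)
    calc _ ≤ ∑ l ∈ Finset.range (n + 1), w l t * ‖f t - f (x l)‖ := by
          refine (norm_sum_le _ _).trans (Finset.sum_le_sum fun l _ => ?_)
          rw [norm_mul, Complex.norm_real, Real.norm_of_nonneg (hw0 l t)]
      _ ≤ ∑ l ∈ Finset.range (n + 1), w l t *
          (L * (n : ℝ) ^ (-β) * (1 + (n : ℝ) ^ 2 * (π ^ 2 / 2) * (1 - Real.cos (t - x l)))) := by
          refine Finset.sum_le_sum fun l _ => mul_le_mul_of_nonneg_left ?_ (hw0 l t)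
          exact periodic_holder_le hβ hβ1 hL hnpos hf h _ _
      _ = L * (n : ℝ) ^ (-β) * (∑ l ∈ Finset.range (n + 1), w l t + (n : ℝ) ^ 2 * (π ^ 2 / 2) *
          ∑ l ∈ Finset.range (n + 1), w l t * (1 - Real.cos (t - x l))) := by
          rw [Finset.mul_sum, ← Finset.sum_add_distrib, Finset.mul_sum]
          refine Finset.sum_congr rfl fun l _ => ?_
          ring
      _ = L * (n : ℝ) ^ (-β) * (B + (n + 1) * (π ^ 2 / 4) * ((n : ℝ) ^ 2 * D)) := by
          rw [show ∑ l ∈ Finset.range (n + 1), w l t = B from h1,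
            show ∑ l ∈ Finset.range (n + 1), w l t * (1 - Real.cos (t - x l)) = _ from h2]
          ring
      _ ≤ L * (K : ℝ) ^ (-β) * (B + (n + 1) * (π ^ 2 / 4) * (10 * A)) := by gcongr
      _ = _ := by rw [hB]; ring

end Jackson

end LoopApprox

namespace LoopApprox

section Wiener

lemma IsTrigPoly.periodic {E : Type*} [AddCommGroup E] [Module ℂ E] {d : ℕ} {P : ℝ → E}
    (h : IsTrigPoly d P) : Function.Periodic P (2 * π) := by
  obtain ⟨c, hc⟩ := h
  intro t
  rw [hc, hc]
  refine Finset.sum_congr rfl fun k _ => ?_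
  have : ((k : ℂ) * ((t + 2 * π : ℝ) : ℂ) * Complex.I) =
      k * t * Complex.I + k * (2 * π * Complex.I) := by push_cast; ring
  rw [this, Complex.exp_add, Complex.exp_int_mul_two_pi_mul_I, mul_one]

lemma IsTrigPoly.exists_primitive {d : ℕ} {T : ℝ → ℂ} (hT : IsTrigPoly d T) :
    ∃ (S : ℝ → ℂ) (a : ℂ), IsTrigPoly d S ∧ ∀ t, HasDerivAt S (T t - a) t := by
  obtain ⟨c, hc⟩ := hT
  refine ⟨fun t => ∑ k ∈ Finset.Icc (-(d : ℤ)) (d : ℤ),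
    Complex.exp (k * t * Complex.I) • (c k / (k * Complex.I)), c 0, ⟨_, fun t => rfl⟩,
    fun t => ?_⟩
  have h0 : c 0 = ∑ k ∈ Finset.Icc (-(d : ℤ)) (d : ℤ), if k = 0 then c k else 0 := by
    rw [Finset.sum_ite_eq' _ (0 : ℤ), if_pos (by simp)]
  rw [hc, h0, ← Finset.sum_sub_distrib]
  refine HasDerivAt.fun_sum fun k _ => ?_
  have h1 : HasDerivAt (fun t : ℝ => (k : ℂ) * t * Complex.I) (k * 1 * Complex.I) t :=
    ((Complex.ofRealCLM.hasDerivAt (x := t)).const_mul (k : ℂ)).mul_const Complex.I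
  refine ((h1.cexp).mul_const (c k / (k * Complex.I))).congr_deriv ?_
  split_ifs with hk
  · simp [hk]
  · have : (k : ℂ) ≠ 0 := by exact_mod_cast hk
    simp only [smul_eq_mul, sub_zero]
    field_simp

/-- Jackson's theorem for functions of class `Lip_{r+β}`. -/
lemma LipClass.jackson {β : ℝ} {r : ℕ} (hβ : 0 < β) (hβ1 : β ≤ 1) {f : ℝ → ℂ}
    (hf : LipClass β r f) : ∃ C : ℝ, 0 ≤ C ∧ ∀ K : ℕ, 1 ≤ K → ∃ T : ℝ → ℂ, IsTrigPoly K T ∧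
      ∀ t, ‖f t - T t‖ ≤ C * (K : ℝ) ^ (-((r : ℝ) + β)) := by
  induction r generalizing f with
  | zero =>
    obtain ⟨pf, C, hC⟩ := hf
    have hC0 : 0 ≤ C := by simpa using (norm_nonneg _).trans (hC 0 1)
    refine ⟨(1 + 5 * π ^ 2 / 2) * C, by positivity, fun K hK => ?_⟩
    simpa using exists_isTrigPoly_of_holder hβ hβ1 hC0 pf hC hK
  | succ r ih =>
    obtain ⟨pf, hd, h'⟩ := hf
    obtain ⟨C, hC0, hC⟩ := ih h'
    refine ⟨(1 + 5 * π ^ 2 / 2) * (2 * C), by positivity, fun K hK => ?_⟩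
    obtain ⟨T, hT, hfT⟩ := hC K hK
    obtain ⟨S, a, hS, hS'⟩ := hT.exists_primitive
    have hKpos : (0 : ℝ) < K := by exact_mod_cast hK
    set ε := C * (K : ℝ) ^ (-((r : ℝ) + β)) with hε
    have hε0 : 0 ≤ ε := by positivity
    have ha : ‖a‖ ≤ ε := by
      have h1 (t : ℝ) : HasDerivAt (fun t : ℝ => f t - S t - a * t) (deriv f t - T t) t := by
        refine (((hd t).hasDerivAt.sub (hS' t)).sub
          ((Complex.ofRealCLM.hasDerivAt (x := t)).const_mul a)).congr_deriv ?_
        simp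
        ring
      have h2 := Convex.norm_image_sub_le_of_norm_hasDerivWithin_le
        (fun t _ => (h1 t).hasDerivWithinAt) (fun t _ => hfT t) convex_univ
        (Set.mem_univ 0) (Set.mem_univ (2 * π))
      have h3 : f (2 * π) = f 0 := by simpa using pf 0
      have h4 : S (2 * π) = S 0 := by simpa using hS.periodic 0
      rw [h3, h4, show f 0 - S 0 - a * (2 * π : ℝ) - (f 0 - S 0 - a * (0 : ℝ)) =
        -(a * (2 * π : ℝ)) by push_cast; ring, norm_neg, norm_mul, Complex.norm_real, sub_zero]
        at h2
      exact le_of_mul_le_mul_right h2 (by simp [Real.pi_ne_zero])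
    have hlip (s t : ℝ) : ‖(f t - S t) - (f s - S s)‖ ≤ 2 * ε * |t - s| ^ (1 : ℝ) := by
      have h1 (t : ℝ) : HasDerivAt (fun t : ℝ => f t - S t) (deriv f t - T t + a) t := by
        refine ((hd t).hasDerivAt.sub (hS' t)).congr_deriv ?_
        ring
      have h2 (t : ℝ) : ‖deriv f t - T t + a‖ ≤ 2 * ε :=
        (norm_add_le _ _).trans (by linarith [hfT t])
      simpa using Convex.norm_image_sub_le_of_norm_hasDerivWithin_le
        (fun t _ => (h1 t).hasDerivWithinAt) (fun t _ => h2 t) convex_univ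
        (Set.mem_univ s) (Set.mem_univ t)
    obtain ⟨Q, hQ, hQ'⟩ := exists_isTrigPoly_of_holder one_pos le_rfl
      (mul_nonneg two_pos.le hε0) (f := fun t => f t - S t)
      (fun t => by simp only [pf t, hS.periodic t]) hlip hK
    refine ⟨fun t => S t + Q t, hS.add hQ, fun t => ?_⟩
    rw [← sub_sub]
    refine (hQ' t).trans_eq ?_
    rw [hε, show -(((r + 1 : ℕ) : ℝ) + β) = -((r : ℝ) + β) + -1 by push_cast; ring,
      Real.rpow_add hKpos]
    ring

lemma sum_icc_extend {d d' : ℕ} (h : d ≤ d') {X : Type*} [AddCommMonoid X] (φ : ℤ → X)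
    (h0 : ∀ k : ℤ, (d : ℤ) < |k| → φ k = 0) :
    ∑ k ∈ Finset.Icc (-(d : ℤ)) (d : ℤ), φ k = ∑ k ∈ Finset.Icc (-(d' : ℤ)) (d' : ℤ), φ k := by
  refine Finset.sum_subset (fun k hk => ?_) fun k hk hk' => h0 k ?_
  · rw [Finset.mem_Icc] at *; omega
  · rw [Finset.mem_Icc] at *
    rw [lt_abs]
    by_contra hc
    exact hk' (by omega)

/-- A quantitative form of the Bernstein absolute convergence theorem. -/
lemma LipClass.exists_trigPoly_absolutely {β : ℝ} {r : ℕ} (hβ : 0 < β) (hβ1 : β ≤ 1)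
    (hα : 1 / 2 < r + β) {f : ℝ → ℂ} (hf : LipClass β r f) :
    ∃ C : ℝ, 0 ≤ C ∧ ∀ j : ℕ, ∃ c : ℤ → ℂ,
      (∀ t : ℝ, ‖f t - ∑ k ∈ Finset.Icc (-((2 ^ j : ℕ) : ℤ)) ((2 ^ j : ℕ) : ℤ),
        Complex.exp (k * t * Complex.I) • c k‖ ≤ C * ((2 : ℝ) ^ j) ^ (-((r : ℝ) + β))) ∧
      ∑ k ∈ Finset.Icc (-((2 ^ j : ℕ) : ℤ)) ((2 ^ j : ℕ) : ℤ), ‖c k‖ ≤ C := by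
  obtain ⟨C, hC0, hC⟩ := hf.jackson hβ hβ1
  set α := (r : ℝ) + β with hαdef
  have h (j : ℕ) : ∃ c : ℤ → ℂ, (∀ k : ℤ, ((2 ^ j : ℕ) : ℤ) < |k| → c k = 0) ∧
      ∀ t : ℝ, ‖f t - ∑ k ∈ Finset.Icc (-((2 ^ j : ℕ) : ℤ)) ((2 ^ j : ℕ) : ℤ),
        Complex.exp (k * t * Complex.I) • c k‖ ≤ C * ((2 : ℝ) ^ j) ^ (-α) := by
    obtain ⟨T, ⟨c, hc⟩, hT⟩ := hC (2 ^ j) Nat.one_le_two_pow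
    refine ⟨fun k => if |k| ≤ ((2 ^ j : ℕ) : ℤ) then c k else 0,
      fun k hk => if_neg (not_le.2 hk), fun t => ?_⟩
    have := hT t
    rw [hc] at this
    push_cast at this ⊢
    refine le_of_eq_of_le (congrArg (fun x => ‖f t - x‖) ?_) this
    refine Finset.sum_congr rfl fun k hk => ?_
    rw [if_pos]
    rw [Finset.mem_Icc] at hk
    exact abs_le.2 hk
  choose c hc0 hc using h
  set q : ℝ := (2 : ℝ) ^ (1 / 2 - α) with hq
  have hq0 : 0 < q := by positivity
  have hq1 : q < 1 := Real.rpow_lt_one_of_one_lt_of_neg one_lt_two (by linarith)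
  have hstep (j : ℕ) : ∑ k ∈ Finset.Icc (-((2 ^ (j + 1) : ℕ) : ℤ)) ((2 ^ (j + 1) : ℕ) : ℤ),
      ‖c (j + 1) k - c j k‖ ≤ 6 * C * q ^ j := by
    have hle : 2 ^ j ≤ 2 ^ (j + 1) := Nat.pow_le_pow_right two_pos (Nat.le_succ j)
    have h1 (t : ℝ) : ‖∑ k ∈ Finset.Icc (-((2 ^ (j + 1) : ℕ) : ℤ)) ((2 ^ (j + 1) : ℕ) : ℤ),
        Complex.exp (k * t * Complex.I) • (c (j + 1) k - c j k)‖ ≤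
        2 * C * ((2 : ℝ) ^ j) ^ (-α) := by
      simp_rw [smul_sub, Finset.sum_sub_distrib]
      have h2 := hc j t
      rw [sum_icc_extend hle (fun k : ℤ => Complex.exp (k * t * Complex.I) • c j k)
        (fun k hk => by rw [hc0 j k hk, smul_zero])] at h2
      have h3 := hc (j + 1) t
      have h4 : ((2 : ℝ) ^ (j + 1)) ^ (-α) ≤ ((2 : ℝ) ^ j) ^ (-α) :=
        Real.rpow_le_rpow_of_nonpos (by positivity)
          (pow_le_pow_right₀ one_le_two (Nat.le_succ j)) (by linarith)
      have h5 : C * ((2 : ℝ) ^ (j + 1)) ^ (-α) ≤ C * ((2 : ℝ) ^ j) ^ (-α) := by gcongr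
      rw [norm_sub_rev] at h3
      refine (norm_sub_le_norm_sub_add_norm_sub _ (f t) _).trans ?_
      linarith
    refine (sum_norm_coeff_le h1).trans ?_
    have h2 : √(2 * ((2 ^ (j + 1) : ℕ) : ℝ) + 1) ≤ 3 * ((2 : ℝ) ^ j) ^ (1 / 2 : ℝ) := by
      rw [← Real.sqrt_eq_rpow]
      refine Real.sqrt_le_iff.2 ⟨by positivity, ?_⟩
      rw [mul_pow, Real.sq_sqrt (by positivity)]
      push_cast
      have : (1 : ℝ) ≤ 2 ^ j := one_le_pow₀ one_le_two
      rw [pow_succ]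
      linarith
    have h3 : ((2 : ℝ) ^ j) ^ (1 / 2 : ℝ) * ((2 : ℝ) ^ j) ^ (-α) = q ^ j := by
      rw [← Real.rpow_add (by positivity), hq, ← Real.rpow_natCast, ← Real.rpow_natCast,
        ← Real.rpow_mul two_pos.le, ← Real.rpow_mul two_pos.le]
      congr 1
      ring
    calc _ ≤ 3 * ((2 : ℝ) ^ j) ^ (1 / 2 : ℝ) * (2 * C * ((2 : ℝ) ^ j) ^ (-α)) := by gcongr
      _ = 6 * C * (((2 : ℝ) ^ j) ^ (1 / 2 : ℝ) * ((2 : ℝ) ^ j) ^ (-α)) := by ring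
      _ = _ := by rw [h3]
  set A := ∑ k ∈ Finset.Icc (-((2 ^ 0 : ℕ) : ℤ)) ((2 ^ 0 : ℕ) : ℤ), ‖c 0 k‖ with hA
  have hA0 : 0 ≤ A := Finset.sum_nonneg fun _ _ => norm_nonneg _
  have hbound (j : ℕ) : ∑ k ∈ Finset.Icc (-((2 ^ j : ℕ) : ℤ)) ((2 ^ j : ℕ) : ℤ), ‖c j k‖ ≤
      A + 6 * C * ∑ i ∈ Finset.range j, q ^ i := by
    induction j with
    | zero => simp [hA]
    | succ j ih =>
      have hle : 2 ^ j ≤ 2 ^ (j + 1) := Nat.pow_le_pow_right two_pos (Nat.le_succ j)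
      rw [sum_icc_extend hle (fun k : ℤ => ‖c j k‖)
        (fun k hk => by rw [hc0 j k hk, norm_zero])] at ih
      rw [Finset.sum_range_succ, mul_add, ← add_assoc]
      refine le_trans ?_ (add_le_add ih (hstep j))
      rw [← Finset.sum_add_distrib]
      refine Finset.sum_le_sum fun k _ => ?_
      linarith [norm_le_norm_add_norm_sub' (c (j + 1) k) (c j k)]
  have hgeom (j : ℕ) : ∑ i ∈ Finset.range j, q ^ i ≤ (1 - q)⁻¹ := by
    rw [← tsum_geometric_of_lt_one hq0.le hq1]
    exact (summable_geometric_of_lt_one hq0.le hq1).sum_le_tsum _ fun _ _ => by positivity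
  have h1q : 0 < 1 - q := by linarith
  refine ⟨C + (A + 6 * C * (1 - q)⁻¹), by positivity, fun j => ⟨c j, fun t => ?_, ?_⟩⟩
  · refine (hc j t).trans ?_
    have : 0 ≤ A + 6 * C * (1 - q)⁻¹ := by positivity
    gcongr
    linarith
  · refine (hbound j).trans ?_
    have : 6 * C * ∑ i ∈ Finset.range j, q ^ i ≤ 6 * C * (1 - q)⁻¹ := by
      gcongr; exact hgeom j
    linarith

end Wiener

end LoopApprox

namespace LoopApprox

section Trotter

variable {A : Type*} [CStarAlgebra A]

/-- `P` agrees with `1 + S` to first order, with the precision of an exponential of norm `B`. -/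
structure FirstOrder (P S : A) (B : ℝ) : Prop where
  nonneg : 0 ≤ B
  norm_sub_one : ‖P - 1‖ ≤ Real.exp B - 1
  norm_sub : ‖P - 1 - S‖ ≤ Real.exp B - 1 - B

lemma FirstOrder.one : FirstOrder (1 : A) 0 0 := ⟨le_rfl, by simp, by simp⟩

lemma FirstOrder.mul {P P' S S' : A} {B B' : ℝ} (h : FirstOrder P S B) (h' : FirstOrder P' S' B') :
    FirstOrder (P * P') (S + S') (B + B') := by
  obtain ⟨h0, h1, h2⟩ := h
  obtain ⟨h0', h1', h2'⟩ := h'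
  have hm : ‖(P - 1) * (P' - 1)‖ ≤ (Real.exp B - 1) * (Real.exp B' - 1) :=
    (norm_mul_le _ _).trans (mul_le_mul h1 h1' (norm_nonneg _) ((norm_nonneg _).trans h1))
  refine ⟨add_nonneg h0 h0', ?_, ?_⟩
  · rw [show P * P' - 1 = (P - 1) * (P' - 1) + (P - 1) + (P' - 1) by noncomm_ring, Real.exp_add]
    refine (norm_add₃_le).trans ?_
    linarith
  · rw [show P * P' - 1 - (S + S') = (P - 1) * (P' - 1) + (P - 1 - S) + (P' - 1 - S') by
      noncomm_ring, Real.exp_add]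
    refine (norm_add₃_le).trans ?_
    linarith

lemma FirstOrder.exp {Y : A} {b : ℝ} (hb : ‖Y‖ ≤ b) : FirstOrder (NormedSpace.exp Y) Y b := by
  have hY := NormedSpace.exp_series_hasSum_exp' (𝕂 := ℂ) Y
  have hR := NormedSpace.exp_series_hasSum_exp' (𝕂 := ℝ) b
  rw [← Real.exp_eq_exp_ℝ] at hR
  have hle (n : ℕ) : ‖((n + 1).factorial⁻¹ : ℂ) • Y ^ (n + 1)‖ ≤
      ((n + 1).factorial⁻¹ : ℝ) • b ^ (n + 1) := by
    rw [norm_smul, smul_eq_mul, norm_inv, Complex.norm_natCast]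
    gcongr
    exact (norm_pow_le' Y (Nat.succ_pos n)).trans (by gcongr)
  refine ⟨(norm_nonneg _).trans hb, ?_, ?_⟩
  · have := ((hasSum_nat_add_iff' 1).2 hY).norm_le_of_bounded ((hasSum_nat_add_iff' 1).2 hR) hle
    simpa using this
  · have := ((hasSum_nat_add_iff' 2).2 hY).norm_le_of_bounded ((hasSum_nat_add_iff' 2).2 hR)
      (fun n => hle (n + 1))
    simpa [Finset.sum_range_succ, sub_sub] using this

lemma norm_pow_sub_pow_le {X Q : A} {m : ℕ} (hX : ‖X‖ ≤ 1) (hQ : ‖Q‖ ≤ 1) :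
    ‖X ^ m - Q ^ m‖ ≤ m * ‖X - Q‖ := by
  induction m with
  | zero => simp
  | succ m ih =>
    rcases Nat.eq_zero_or_pos m with rfl | hm
    · simp
    have h : X ^ (m + 1) - Q ^ (m + 1) = X ^ m * (X - Q) + (X ^ m - Q ^ m) * Q := by
      rw [pow_succ, pow_succ]; noncomm_ring
    have hXm : ‖X ^ m‖ ≤ 1 := (norm_pow_le' X hm).trans (pow_le_one₀ (norm_nonneg _) hX)
    rw [h]
    push_cast
    calc _ ≤ ‖X ^ m‖ * ‖X - Q‖ + ‖X ^ m - Q ^ m‖ * ‖Q‖ :=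
          (norm_add_le _ _).trans (add_le_add (norm_mul_le _ _) (norm_mul_le _ _))
      _ ≤ 1 * ‖X - Q‖ + m * ‖X - Q‖ * 1 := by gcongr
      _ = _ := by ring

/-- The one-parameter family `1 + (e^{ix} - 1) p`. -/
noncomputable def phase (p : A) (x : ℝ) : A := 1 + (Complex.exp (x * Complex.I) - 1) • p

lemma phase_mul {p : A} (hp : p * p = p) (x y : ℝ) :
    phase p x * phase p y = phase p (x + y) := by
  simp only [phase, Complex.ofReal_add, add_mul, mul_add, Complex.exp_add, one_mul, mul_one,
    smul_mul_assoc, mul_smul_comm, hp]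
  module

lemma phase_zero (p : A) : phase p 0 = 1 := by simp [phase]

lemma isTrigPoly_phase (p : A) (k : ℤ) {d : ℕ} (hk : |k| ≤ d) :
    IsTrigPoly d (fun t => phase p (k * t)) := by
  have h : (fun t : ℝ => phase p (k * t)) = fun t : ℝ => (1 - p) +
      Complex.exp (k * t * Complex.I) • p := by
    funext t
    simp only [phase, sub_smul, one_smul]
    push_cast
    abel
  rw [h]
  exact (isTrigPoly_const d _).add (isTrigPoly_monomial hk p)

/-- The skew-adjoint element `z a - (z a)⋆`. -/
noncomputable def skewOf (a : A) (z : ℂ) : A := z • a - (starRingEnd ℂ z) • star a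

lemma norm_skewOf_le (a : A) (z : ℂ) : ‖skewOf a z‖ ≤ 2 * ‖a‖ * ‖z‖ := by
  refine (norm_sub_le _ _).trans ?_
  rw [norm_smul, norm_smul, norm_star, RCLike.norm_conj]
  linarith

lemma skewOf_mul_ofReal (a : A) (z : ℂ) (c : ℝ) : skewOf a (c * z) = (c : ℂ) • skewOf a z := by
  simp [skewOf, smul_sub, smul_smul]

lemma skewOf_sum (a : A) {κ : Type*} (s : Finset κ) (z : κ → ℂ) :
    skewOf a (∑ k ∈ s, z k) = ∑ k ∈ s, skewOf a (z k) := by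
  simp [skewOf, Finset.sum_smul, Finset.sum_sub_distrib]

lemma skewOf_sub (a : A) (z w : ℂ) : skewOf a (z - w) = skewOf a z - skewOf a w := by
  simp only [skewOf, sub_smul, map_sub]
  abel

lemma exp_skewOf_phase {a p : A} (hpa : p * a = a) (hap : a * p = 0) (hpp : p * p = p)
    (hps : star p = p) (z : ℂ) (x : ℝ) :
    NormedSpace.exp (skewOf a (Complex.exp (x * Complex.I) * z)) =
      phase p x * NormedSpace.exp (skewOf a z) * phase p (-x) := by
  let _ : NormedAlgebra ℚ A := NormedAlgebra.restrictScalars ℚ ℂ A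
  let u : Aˣ := ⟨phase p x, phase p (-x), by rw [phase_mul hpp]; simp [phase_zero],
    by rw [phase_mul hpp]; simp [phase_zero]⟩
  have hsa : star a * p = star a := by rw [← hps, ← star_mul, hpa]
  have has : p * star a = 0 := by rw [← hps, ← star_mul, hap, star_zero]
  have h1 : phase p x * a * phase p (-x) = Complex.exp (x * Complex.I) • a := by
    simp only [phase, add_mul, mul_add, one_mul, mul_one, smul_mul_assoc, mul_smul_comm, hpa, hap,
      smul_zero, add_zero]
    module
  have h2 : phase p x * star a * phase p (-x) = Complex.exp (-(x * Complex.I)) • star a := by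
    simp only [phase, add_mul, mul_add, one_mul, mul_one, smul_mul_assoc, mul_smul_comm, hsa, has,
      smul_zero, add_zero, Complex.ofReal_neg, neg_mul]
    module
  have h3 := NormedSpace.exp_units_conj u (skewOf a z)
  change NormedSpace.exp (phase p x * _ * phase p (-x)) = phase p x * _ * phase p (-x) at h3
  rw [← h3]
  congr 1
  simp only [skewOf, mul_sub, sub_mul, mul_smul_comm, smul_mul_assoc, h1, h2, smul_smul, map_mul,
    ← Complex.exp_conj, Complex.conj_ofReal, Complex.conj_I, mul_neg]
  simp only [mul_comm]

lemma exists_isTrigPoly_firstOrder_range {a p : A} (hpa : p * a = a) (hap : a * p = 0)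
    (hpp : p * p = p) (hps : star p = p) (G : Submonoid A)
    (hG : ∀ z, NormedSpace.exp (skewOf a z) ∈ G) (K : ℕ) (c : ℤ → ℂ) (L : ℕ) :
    ∃ Q : ℝ → A,
      IsTrigPoly (K + L) (fun t => Q t * phase p (((L : ℤ) - K : ℤ) * t)) ∧ (∀ t, Q t ∈ G) ∧
      ∀ t : ℝ, FirstOrder (Q t) (∑ l ∈ Finset.range L,
        skewOf a (Complex.exp (((l : ℤ) - K : ℤ) * t * Complex.I) • c ((l : ℤ) - K)))
        (∑ l ∈ Finset.range L, 2 * ‖a‖ * ‖c ((l : ℤ) - K)‖) := by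
  induction L with
  | zero =>
    refine ⟨fun _ => 1, ?_, fun _ => G.one_mem, fun t => by simpa using FirstOrder.one⟩
    simp only [one_mul]
    exact isTrigPoly_phase p _ (by simp)
  | succ L ih =>
    obtain ⟨Q, hQ1, hQ2, hQ3⟩ := ih
    generalize hk : ((L : ℤ) - K : ℤ) = k at hQ1
    have hk' : (((L + 1 : ℕ) : ℤ) - K : ℤ) = k + 1 := by push_cast; omega
    refine ⟨fun t => Q t * NormedSpace.exp (skewOf a (Complex.exp (k * t * Complex.I) • c k)), ?_,
      fun t => G.mul_mem (hQ2 t) (hG _), fun t => ?_⟩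
    · rw [hk']
      have h (t : ℝ) : Q t * NormedSpace.exp (skewOf a (Complex.exp (k * t * Complex.I) • c k)) *
          phase p ((k + 1 : ℤ) * t) =
          Q t * phase p (k * t) * NormedSpace.exp (skewOf a (c k)) * phase p ((1 : ℤ) * t) := by
        have h1 := exp_skewOf_phase hpa hap hpp hps (c k) (k * t)
        push_cast at h1
        rw [smul_eq_mul, h1]
        simp only [mul_assoc, phase_mul hpp]
        rw [show -((k : ℝ) * t) + ((k + 1 : ℤ) : ℝ) * t = ((1 : ℤ) : ℝ) * t by push_cast; ring]
      rw [funext h]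
      exact ((hQ1.mul (isTrigPoly_const 0 _)).mul
        (isTrigPoly_phase p 1 (d := 1) (by simp))).mono (by omega)
    · rw [Finset.sum_range_succ, Finset.sum_range_succ, hk]
      refine (hQ3 t).mul (FirstOrder.exp ((norm_skewOf_le _ _).trans_eq ?_))
      rw [norm_smul, show (k : ℂ) * t * Complex.I = ((k * t : ℝ) : ℂ) * Complex.I by
        push_cast; ring, Complex.norm_exp_ofReal_mul_I, one_mul]

lemma sum_icc_eq_sum_range {X : Type*} [AddCommMonoid X] (K : ℕ) (φ : ℤ → X) :
    ∑ k ∈ Finset.Icc (-(K : ℤ)) K, φ k = ∑ l ∈ Finset.range (2 * K + 1), φ ((l : ℤ) - K) := by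
  symm
  refine Finset.sum_bij (fun l _ => (l : ℤ) - K) ?_ ?_ ?_ ?_
  · intro l hl; rw [Finset.mem_range] at hl; rw [Finset.mem_Icc]; omega
  · intro l _ l' _ h; omega
  · intro k hk
    rw [Finset.mem_Icc] at hk
    exact ⟨(k + K).toNat, by rw [Finset.mem_range]; omega, by omega⟩
  · intro l _; rfl

lemma exists_isTrigPoly_firstOrder {a p : A} (hpa : p * a = a) (hap : a * p = 0) (hpp : p * p = p)
    (hps : star p = p) (G : Submonoid A) (hG : ∀ z, NormedSpace.exp (skewOf a z) ∈ G)
    (K : ℕ) (c : ℤ → ℂ) :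
    ∃ Q : ℝ → A, IsTrigPoly (4 * K + 2) Q ∧ (∀ t, Q t ∈ G) ∧
      ∀ t : ℝ, FirstOrder (Q t) (skewOf a (∑ k ∈ Finset.Icc (-(K : ℤ)) K,
        Complex.exp (k * t * Complex.I) • c k))
        (2 * ‖a‖ * ∑ k ∈ Finset.Icc (-(K : ℤ)) K, ‖c k‖) := by
  obtain ⟨Q, hQ1, hQ2, hQ3⟩ :=
    exists_isTrigPoly_firstOrder_range hpa hap hpp hps G hG K c (2 * K + 1)
  have hk : (((2 * K + 1 : ℕ) : ℤ) - K : ℤ) = K + 1 := by push_cast; ring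
  rw [hk] at hQ1
  refine ⟨Q, ?_, hQ2, fun t => ?_⟩
  · have h (t : ℝ) : Q t = Q t * phase p ((K + 1 : ℤ) * t) * phase p ((-(K + 1) : ℤ) * t) := by
      rw [mul_assoc, phase_mul hpp, show ((K + 1 : ℤ) : ℝ) * t + ((-(K + 1) : ℤ) : ℝ) * t = 0 by
        push_cast; ring, phase_zero, mul_one]
    rw [funext h]
    refine (hQ1.mul (isTrigPoly_phase p _ (d := K + 1) ?_)).mono (by omega)
    rw [abs_neg, abs_of_nonneg (by omega)]
    push_cast
    exact le_rfl
  · have h := hQ3 t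
    rw [← skewOf_sum, ← Finset.mul_sum] at h
    rwa [sum_icc_eq_sum_range, sum_icc_eq_sum_range]

lemma IsTrigPoly.pow {d : ℕ} {P : ℝ → A} (hP : IsTrigPoly d P) (m : ℕ) :
    IsTrigPoly (m * d) (fun t => P t ^ m) := by
  induction m with
  | zero => simpa using isTrigPoly_const _ (1 : A)
  | succ m ih =>
    simp_rw [pow_succ]
    exact (ih.mul hP).mono (by rw [Nat.succ_mul])

end Trotter

end LoopApprox

namespace LoopApprox

section Approximable

variable {A : Type*} [CStarAlgebra A]

/-- The loop `U` is approximated by trigonometric polynomials with values in `G`, at the rate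
`2^{-jα}` for degrees `O(2^{j(1+α)})`. -/
def Approximable (α : ℝ) (G : Submonoid A) (U : ℝ → A) : Prop :=
  ∃ C D : ℝ, 0 ≤ C ∧ 0 ≤ D ∧ ∀ j : ℕ, ∃ (d : ℕ) (P : ℝ → A), IsTrigPoly d P ∧ (∀ t, P t ∈ G) ∧
    (d : ℝ) ≤ D * ((2 : ℝ) ^ j) ^ (1 + α) ∧ ∀ t, ‖U t - P t‖ ≤ C * ((2 : ℝ) ^ j) ^ (-α)

lemma Approximable.const {α : ℝ} {G : Submonoid A} {g : A} (hg : g ∈ G) :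
    Approximable α G (fun _ => g) :=
  ⟨0, 0, le_rfl, le_rfl, fun j => ⟨0, fun _ => g, isTrigPoly_const 0 g, fun _ => hg, by simp,
    fun t => by simp⟩⟩

lemma Approximable.mul {α : ℝ} {G : Submonoid A} (hG : ∀ g ∈ G, ‖g‖ ≤ 1) {U V : ℝ → A}
    (hU : Approximable α G U) (hV : Approximable α G V) (hUG : ∀ t, U t ∈ G) :
    Approximable α G (fun t => U t * V t) := by
  obtain ⟨C, D, hC, hD, h⟩ := hU
  obtain ⟨C', D', hC', hD', h'⟩ := hV
  refine ⟨C + C', D + D', by positivity, by positivity, fun j => ?_⟩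
  obtain ⟨d, P, hP, hPG, hd, hUP⟩ := h j
  obtain ⟨d', P', hP', hPG', hd', hVP⟩ := h' j
  refine ⟨d + d', fun t => P t * P' t, hP.mul hP', fun t => G.mul_mem (hPG t) (hPG' t), ?_,
    fun t => ?_⟩
  · push_cast
    linarith
  · have h1 : U t * V t - P t * P' t = U t * (V t - P' t) + (U t - P t) * P' t := by noncomm_ring
    rw [h1]
    calc _ ≤ ‖U t‖ * ‖V t - P' t‖ + ‖U t - P t‖ * ‖P' t‖ :=
          (norm_add_le _ _).trans (add_le_add (norm_mul_le _ _) (norm_mul_le _ _))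
      _ ≤ 1 * (C' * ((2 : ℝ) ^ j) ^ (-α)) + (C * ((2 : ℝ) ^ j) ^ (-α)) * 1 := by
          gcongr
          · exact hG _ (hUG t)
          · exact hVP t
          · exact hUP t
          · exact hG _ (hPG' t)
      _ = _ := by ring

lemma norm_le_one_of_mem_unitary {u : A} (hu : u ∈ unitary A) : ‖u‖ ≤ 1 := by
  rcases subsingleton_or_nontrivial A with _ | _
  · simp [Subsingleton.elim u 0]
  · exact (CStarRing.norm_of_mem_unitary hu).le

lemma norm_exp_le_one {Y : A} (hY : star Y = -Y) : ‖NormedSpace.exp Y‖ ≤ 1 := by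
  let _ : NormedAlgebra ℚ A := NormedAlgebra.restrictScalars ℚ ℂ A
  exact norm_le_one_of_mem_unitary
    (NormedSpace.exp_mem_unitary_of_mem_skewAdjoint (skewAdjoint.mem_iff.2 hY))

lemma star_skewOf (a : A) (z : ℂ) : star (skewOf a z) = -skewOf a z := by
  simp [skewOf, star_smul]

lemma exists_isTrigPoly_firstOrder_sum {ι : Type*} (s : Finset ι) {a p : ι → A}
    (hpa : ∀ i, p i * a i = a i) (hap : ∀ i, a i * p i = 0) (hpp : ∀ i, p i * p i = p i)
    (hps : ∀ i, star (p i) = p i) (G : Submonoid A)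
    (hG : ∀ i z, NormedSpace.exp (skewOf (a i) z) ∈ G) (K : ℕ) (c : ι → ℤ → ℂ) :
    ∃ Q : ℝ → A, IsTrigPoly (s.card * (4 * K + 2)) Q ∧ (∀ t, Q t ∈ G) ∧
      ∀ t : ℝ, FirstOrder (Q t) (∑ i ∈ s, skewOf (a i) (∑ k ∈ Finset.Icc (-(K : ℤ)) K,
        Complex.exp (k * t * Complex.I) • c i k))
        (∑ i ∈ s, 2 * ‖a i‖ * ∑ k ∈ Finset.Icc (-(K : ℤ)) K, ‖c i k‖) := by
  classical
  induction s using Finset.induction_on with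
  | empty =>
    exact ⟨fun _ => 1, isTrigPoly_const _ _, fun _ => G.one_mem,
      fun t => by simpa using FirstOrder.one⟩
  | insert i s hi ih =>
    obtain ⟨Q, hQ, hQG, hQF⟩ := ih
    obtain ⟨R, hR, hRG, hRF⟩ :=
      exists_isTrigPoly_firstOrder (hpa i) (hap i) (hpp i) (hps i) G (hG i) K (c i)
    refine ⟨fun t => R t * Q t, ?_, fun t => G.mul_mem (hRG t) (hQG t), fun t => ?_⟩
    · refine (hR.mul hQ).mono ?_
      rw [Finset.card_insert_of_notMem hi, add_mul, one_mul, add_comm]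
    · rw [Finset.sum_insert hi, Finset.sum_insert hi]
      exact (hRF t).mul (hQF t)

lemma approximable_exp {β : ℝ} {r : ℕ} (hβ : 0 < β) (hβ1 : β ≤ 1) (hα : 1 / 2 < r + β)
    {ι : Type*} (s : Finset ι) {a p : ι → A}
    (hpa : ∀ i, p i * a i = a i) (hap : ∀ i, a i * p i = 0) (hpp : ∀ i, p i * p i = p i)
    (hps : ∀ i, star (p i) = p i) (G : Submonoid A) (hG1 : ∀ g ∈ G, ‖g‖ ≤ 1)
    (hG : ∀ i z, NormedSpace.exp (skewOf (a i) z) ∈ G) {f : ι → ℝ → ℂ}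
    (hf : ∀ i, LipClass β r (f i)) :
    Approximable (r + β) G (fun t => NormedSpace.exp (∑ i ∈ s, skewOf (a i) (f i t))) := by
  let _ : NormedAlgebra ℚ A := NormedAlgebra.restrictScalars ℚ ℂ A
  set α := (r : ℝ) + β with hαdef
  choose M hM0 hM using fun i => (hf i).exists_bound hβ
  choose C hC0 hC using fun i => (hf i).exists_trigPoly_absolutely hβ hβ1 hα
  set B : ℝ := ∑ i ∈ s, 2 * ‖a i‖ * (C i + M i) with hB
  have hB0 : 0 ≤ B := Finset.sum_nonneg fun i _ =>
    mul_nonneg (by positivity) (add_nonneg (hC0 i) (hM0 i))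
  set M0 : ℕ := ⌈B⌉₊ + 1 with hM0'
  have hM0B : B ≤ M0 := by
    rw [hM0']; push_cast; exact (Nat.le_ceil B).trans (by linarith)
  have hexp {x : ℝ} (hx : 0 ≤ x) (hx1 : x ≤ 1) : Real.exp x - 1 - x ≤ x ^ 2 :=
    (le_abs_self _).trans (Real.abs_exp_sub_one_sub_id_le (by rwa [abs_of_nonneg hx]))
  refine ⟨2 * B ^ 2 + B, M0 * (12 * s.card), by positivity, by positivity, fun j => ?_⟩
  choose c hc hcs using fun i => hC i j
  set K : ℝ := (2 : ℝ) ^ j with hK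
  have hK1 : 1 ≤ K := one_le_pow₀ one_le_two
  have hKpos : 0 < K := by positivity
  set m : ℕ := M0 * ⌈K ^ α⌉₊ with hm
  have hα0 : 0 < α := by linarith
  have hKα1 : 1 ≤ K ^ α := Real.one_le_rpow hK1 hα0.le
  have hceil : K ^ α ≤ (⌈K ^ α⌉₊ : ℝ) := Nat.le_ceil _
  have hM01 : (1 : ℝ) ≤ M0 := by rw [hM0']; push_cast; linarith [Nat.cast_nonneg (α := ℝ) ⌈B⌉₊]
  have hmB : B ≤ m := by
    rw [hm]; push_cast
    nlinarith
  have hmK : K ^ α ≤ m := by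
    rw [hm]; push_cast
    nlinarith
  have hm1 : (1 : ℝ) ≤ m := hKα1.trans hmK
  have hm0 : (0 : ℝ) < m := by linarith
  set l : ℝ := (m : ℝ)⁻¹ with hl
  have hl0 : 0 < l := inv_pos.2 hm0
  have hlm : l * m = 1 := inv_mul_cancel₀ hm0.ne'
  have hlB : l * B ≤ 1 := by
    calc l * B ≤ l * m := by gcongr
      _ = 1 := hlm
  have hlK : l ≤ K ^ (-α) := by
    rw [Real.rpow_neg hKpos.le, hl]
    exact inv_anti₀ (by positivity) hmK
  obtain ⟨Q, hQ, hQG, hQF⟩ := exists_isTrigPoly_firstOrder_sum s hpa hap hpp hps G hG (2 ^ j)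
    (fun i k => (l : ℂ) * c i k)
  refine ⟨m * (s.card * (4 * 2 ^ j + 2)), fun t => Q t ^ m, hQ.pow m,
    fun t => G.pow_mem (hQG t) m, ?_, fun t => ?_⟩
  · have h1 : (⌈K ^ α⌉₊ : ℝ) ≤ 2 * K ^ α := by
      linarith [Nat.ceil_lt_add_one (show 0 ≤ K ^ α by positivity)]
    have h2 : 4 * K + 2 ≤ 6 * K := by linarith
    rw [Real.rpow_add hKpos, Real.rpow_one, hm]
    push_cast
    rw [← hK]
    calc _ ≤ M0 * (2 * K ^ α) * (s.card * (6 * K)) := by gcongr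
      _ = _ := by ring
  · set V := ∑ i ∈ s, skewOf (a i) (f i t) with hV
    set T : ι → ℂ := fun i => ∑ k ∈ Finset.Icc (-((2 ^ j : ℕ) : ℤ)) ((2 ^ j : ℕ) : ℤ),
        Complex.exp (k * t * Complex.I) • c i k with hT
    set VK := ∑ i ∈ s, skewOf (a i) (T i) with hVK
    have hVs : star V = -V := by
      simp [hV, star_sum, star_skewOf]
    have hlVs : star ((l : ℂ) • V) = -((l : ℂ) • V) := by
      simp [star_smul, hVs]
    have hpow : NormedSpace.exp V = NormedSpace.exp ((l : ℂ) • V) ^ m := by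
      rw [← NormedSpace.exp_nsmul, ← Nat.cast_smul_eq_nsmul ℂ, smul_smul,
        show (m : ℂ) * (l : ℂ) = 1 by rw [mul_comm]; exact_mod_cast hlm, one_smul]
    have hVB : ‖(l : ℂ) • V‖ ≤ l * B := by
      rw [norm_smul, Complex.norm_real, Real.norm_of_nonneg hl0.le]
      gcongr
      refine (norm_sum_le _ _).trans (Finset.sum_le_sum fun i _ => (norm_skewOf_le _ _).trans ?_)
      gcongr
      linarith [hM i t, hC0 i]
    have hX := (FirstOrder.exp hVB).norm_sub.trans (hexp (by positivity) hlB)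
    obtain ⟨hb0, -, hQ2⟩ := hQF t
    have hS : ∑ i ∈ s, skewOf (a i) (∑ k ∈ Finset.Icc (-((2 ^ j : ℕ) : ℤ)) ((2 ^ j : ℕ) : ℤ),
        Complex.exp (k * t * Complex.I) • ((l : ℂ) * c i k)) = (l : ℂ) • VK := by
      rw [hVK, Finset.smul_sum]
      refine Finset.sum_congr rfl fun i _ => ?_
      rw [← skewOf_mul_ofReal, hT, Finset.mul_sum]
      congr 1
      refine Finset.sum_congr rfl fun k _ => ?_
      simp only [smul_eq_mul]
      ring
    rw [hS] at hQ2
    have hbB : ∑ i ∈ s, 2 * ‖a i‖ * ∑ k ∈ Finset.Icc (-((2 ^ j : ℕ) : ℤ)) ((2 ^ j : ℕ) : ℤ),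
        ‖(l : ℂ) * c i k‖ ≤ l * B := by
      rw [hB, Finset.mul_sum]
      refine Finset.sum_le_sum fun i _ => ?_
      simp_rw [norm_mul, Complex.norm_real, Real.norm_of_nonneg hl0.le, ← Finset.mul_sum]
      calc _ ≤ 2 * ‖a i‖ * (l * (C i + M i)) := by
            gcongr
            linarith [hcs i, hM0 i]
        _ = _ := by ring
    have hQ3 := (hQ2.trans (hexp hb0 (hbB.trans hlB))).trans (pow_le_pow_left₀ hb0 hbB 2)
    have hVV : ‖V - VK‖ ≤ B * K ^ (-α) := by
      rw [hV, hVK, ← Finset.sum_sub_distrib, hB, Finset.sum_mul]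
      refine (norm_sum_le _ _).trans (Finset.sum_le_sum fun i _ => ?_)
      rw [← skewOf_sub]
      refine (norm_skewOf_le _ _).trans ?_
      rw [mul_assoc (2 * ‖a i‖)]
      gcongr
      refine (hc i t).trans ?_
      gcongr
      linarith [hM0 i]
    have hXQ : ‖NormedSpace.exp ((l : ℂ) • V) - Q t‖ ≤
        (l * B) ^ 2 + (l * B) ^ 2 + l * (B * K ^ (-α)) := by
      rw [show NormedSpace.exp ((l : ℂ) • V) - Q t =
        (NormedSpace.exp ((l : ℂ) • V) - 1 - (l : ℂ) • V) - (Q t - 1 - (l : ℂ) • VK) +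
          (l : ℂ) • (V - VK) by rw [smul_sub]; abel]
      refine (norm_add_le _ _).trans (add_le_add ((norm_sub_le _ _).trans (add_le_add hX hQ3)) ?_)
      rw [norm_smul, Complex.norm_real, Real.norm_of_nonneg hl0.le]
      gcongr
    change ‖NormedSpace.exp V - Q t ^ m‖ ≤ _
    rw [hpow]
    refine (norm_pow_sub_pow_le (norm_exp_le_one hlVs) (hG1 _ (hQG t))).trans ?_
    calc _ ≤ (m : ℝ) * ((l * B) ^ 2 + (l * B) ^ 2 + l * (B * K ^ (-α))) := by gcongr
      _ = (l * m) * (2 * B ^ 2 * l + B * K ^ (-α)) := by ring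
      _ ≤ 1 * (2 * B ^ 2 * K ^ (-α) + B * K ^ (-α)) := by rw [hlm]; gcongr
      _ = _ := by ring

end Approximable

end LoopApprox

namespace LoopApprox

section Logarithm

open scoped ContDiff

variable {A : Type*} [CStarAlgebra A]

lemma exists_logarithm {η : ℝ} (hη : 0 < η) : ∃ δ : ℝ, 0 < δ ∧ ∃ L : A → A,
    ContDiffOn ℝ ∞ L (Metric.ball 1 δ) ∧ ∀ W ∈ Metric.ball (1 : A) δ,
      NormedSpace.exp (L W) = W ∧ ‖L W‖ < η ∧ (W ∈ unitary A → star (L W) = -L W) := by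
  let _ : NormedAlgebra ℚ A := NormedAlgebra.restrictScalars ℚ ℂ A
  have hc : ContDiffAt ℝ ω (NormedSpace.exp : A → A) 0 :=
    (NormedSpace.exp_analytic (𝕂 := ℝ) (0 : A)).contDiffAt
  have hd : HasFDerivAt (NormedSpace.exp : A → A)
      ((ContinuousLinearEquiv.refl ℝ A : A ≃L[ℝ] A) : A →L[ℝ] A) 0 :=
    (hasStrictFDerivAt_exp_zero (𝕂 := ℝ) (𝔸 := A)).hasFDerivAt
  set e := hc.toOpenPartialHomeomorph (NormedSpace.exp : A → A) hd (by simp) with he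
  have he0 : (e : A → A) = NormedSpace.exp := rfl
  have h0 : (0 : A) ∈ e.source := hc.mem_toOpenPartialHomeomorph_source hd (by simp)
  have he1 : e 0 = 1 := by rw [he0, NormedSpace.exp_zero]
  have h1 : (1 : A) ∈ e.target := he1 ▸ e.map_source h0
  have hs1 : e.symm 1 = 0 := by rw [← he1]; exact e.left_inv h0
  have hsc : ContDiffAt ℝ ω e.symm 1 :=
    e.contDiffAt_symm h1 (by rw [hs1]; exact hd) (by rw [hs1]; exact hc)
  obtain ⟨u, hu, hcu⟩ := hsc.contDiffOn (m := ω) le_rfl (by simp)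
  obtain ⟨ε, hε, hεs⟩ := Metric.isOpen_iff.1 e.open_source 0 h0
  have hcont : ContinuousAt e.symm 1 := e.continuousAt_symm h1
  have hball : e.symm ⁻¹' Metric.ball 0 (min ε η) ∈ nhds (1 : A) :=
    hcont.preimage_mem_nhds (by rw [hs1]; exact Metric.ball_mem_nhds _ (lt_min hε hη))
  obtain ⟨δ, hδ, hδs⟩ := Metric.mem_nhds_iff.1
    (Filter.inter_mem (Filter.inter_mem hu hball) (e.open_target.mem_nhds h1))
  refine ⟨δ, hδ, e.symm, (hcu.mono fun x hx => (hδs hx).1.1).of_le le_top, fun W hW => ?_⟩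
  obtain ⟨⟨-, hWb⟩, hWt⟩ := hδs hW
  have hn : ‖e.symm W‖ < min ε η := by simpa using hWb
  have hexp : NormedSpace.exp (e.symm W) = W := e.right_inv hWt
  refine ⟨hexp, hn.trans_le (min_le_right _ _), fun hWu => ?_⟩
  have hs : star (e.symm W) ∈ e.source :=
    hεs (by simpa using hn.trans_le (min_le_left _ _))
  have hm : -e.symm W ∈ e.source :=
    hεs (by simpa using hn.trans_le (min_le_left _ _))
  refine e.injOn hs hm ?_
  rw [he0, ← NormedSpace.star_exp, hexp]
  have h2 : NormedSpace.exp (-e.symm W) * W = 1 := by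
    conv_lhs => rw [← hexp]
    rw [hexp]
    nth_rw 2 [← hexp]
    rw [← NormedSpace.exp_add_of_commute (Commute.refl _).neg_left, neg_add_cancel,
      NormedSpace.exp_zero]
  exact (left_inv_eq_right_inv h2 (Unitary.mul_star_self_of_mem hWu)).symm

end Logarithm

end LoopApprox

namespace LoopApprox

section Matrices

open scoped Matrix.Norms.L2Operator ContDiff

variable {N : ℕ}

lemma det_exp_of_conjTranspose_eq_neg {Y : Matrix (Fin N) (Fin N) ℂ} (hY : star Y = -Y) :
    (NormedSpace.exp Y).det = Complex.exp Y.trace := by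
  have hH : (((-Complex.I) • Y : Matrix (Fin N) (Fin N) ℂ)).IsHermitian := by
    rw [Matrix.IsHermitian, ← Matrix.star_eq_conjTranspose, star_smul, hY]
    simp
  set H := (-Complex.I) • Y with hHdef
  have hYH : Y = Complex.I • H := by
    rw [hHdef, smul_smul]; simp
  set W := hH.eigenvectorUnitary with hW
  set D : Fin N → ℂ := fun i => (hH.eigenvalues i : ℂ) with hD
  have hspec : H = (W : Matrix (Fin N) (Fin N) ℂ) * Matrix.diagonal D *
      star (W : Matrix (Fin N) (Fin N) ℂ) := by
    have := hH.spectral_theorem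
    rw [Unitary.conjStarAlgAut_apply] at this
    exact this
  have hu1 : (W : Matrix (Fin N) (Fin N) ℂ) * star (W : Matrix (Fin N) (Fin N) ℂ) = 1 :=
    Unitary.mul_star_self_of_mem W.2
  have hu2 : star (W : Matrix (Fin N) (Fin N) ℂ) * (W : Matrix (Fin N) (Fin N) ℂ) = 1 :=
    Unitary.star_mul_self_of_mem W.2
  let u : (Matrix (Fin N) (Fin N) ℂ)ˣ := ⟨W, star (W : Matrix (Fin N) (Fin N) ℂ), hu1, hu2⟩
  have hYu : Y = (u : Matrix (Fin N) (Fin N) ℂ) * Matrix.diagonal (Complex.I • D) *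
      ((u⁻¹ : (Matrix (Fin N) (Fin N) ℂ)ˣ) : Matrix (Fin N) (Fin N) ℂ) := by
    rw [hYH, hspec, Matrix.diagonal_smul]
    simp [u]
  have htr : Y.trace = ∑ i, Complex.I * D i := by
    rw [hYu, Matrix.trace_mul_cycle, Units.inv_mul, one_mul, Matrix.trace_diagonal]
    simp
  rw [htr, Complex.exp_sum]
  conv_lhs => rw [hYu]
  rw [Matrix.exp_units_conj, Matrix.exp_diagonal, Matrix.det_units_conj, Matrix.det_diagonal]
  refine Finset.prod_congr rfl fun i _ => ?_
  rw [Pi.coe_exp, Complex.exp_eq_exp_ℂ]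
  rfl

lemma norm_le_one_of_mem_specialUnitaryGroup {g : Matrix (Fin N) (Fin N) ℂ}
    (hg : g ∈ Matrix.specialUnitaryGroup (Fin N) ℂ) : ‖g‖ ≤ 1 :=
  norm_le_one_of_mem_unitary (Matrix.mem_specialUnitaryGroup_iff.1 hg).1

/-- The nilpotent matrices into whose skew parts a traceless skew-Hermitian matrix splits. -/
noncomputable def rootMatrix (i₀ : Fin N) (x : Fin N × Fin N) : Matrix (Fin N) (Fin N) ℂ :=
  if x.1 = x.2 then
    (2 : ℂ)⁻¹ • (Matrix.single x.1 x.1 1 - Matrix.single x.1 i₀ 1 + Matrix.single i₀ x.1 1 -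
      Matrix.single i₀ i₀ 1)
  else (2 : ℂ)⁻¹ • Matrix.single x.1 x.2 1

/-- The projections onto the ranges of the matrices `rootMatrix i₀ x`. -/
noncomputable def rootProj (i₀ : Fin N) (x : Fin N × Fin N) : Matrix (Fin N) (Fin N) ℂ :=
  if x.1 = x.2 ∧ x.1 ≠ i₀ then
    (2 : ℂ)⁻¹ • (Matrix.single x.1 x.1 1 + Matrix.single x.1 i₀ 1 + Matrix.single i₀ x.1 1 +
      Matrix.single i₀ i₀ 1)
  else Matrix.single x.1 x.1 1

lemma star_single (i j : Fin N) :
    star (Matrix.single i j (1 : ℂ)) = Matrix.single j i 1 := by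
  simp [Matrix.star_eq_conjTranspose, Matrix.conjTranspose_single]

lemma rootProj_mul_rootMatrix (i₀ : Fin N) (x : Fin N × Fin N) :
    rootProj i₀ x * rootMatrix i₀ x = rootMatrix i₀ x := by
  obtain ⟨i, j⟩ := x
  unfold rootProj rootMatrix
  by_cases hij : i = j
  · subst hij
    by_cases hi : i = i₀
    · subst hi; simp
    · have hi' : i₀ ≠ i := Ne.symm hi
      simp only [hi, ne_eq, not_false_eq_true, and_self, if_true, smul_mul_smul_comm, add_mul,
        mul_sub, mul_add, Matrix.single_mul_single_same, Matrix.single_mul_single_of_ne _ _ _ _ hi,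
        Matrix.single_mul_single_of_ne _ _ _ _ hi', mul_one]
      module
  · simp [hij, Matrix.single_mul_single_same]

lemma rootMatrix_mul_rootProj (i₀ : Fin N) (x : Fin N × Fin N) :
    rootMatrix i₀ x * rootProj i₀ x = 0 := by
  obtain ⟨i, j⟩ := x
  unfold rootProj rootMatrix
  by_cases hij : i = j
  · subst hij
    by_cases hi : i = i₀
    · subst hi; simp
    · have hi' : i₀ ≠ i := Ne.symm hi
      simp only [hi, ne_eq, not_false_eq_true, and_self, if_true, smul_mul_smul_comm, add_mul,
        sub_mul, mul_add, Matrix.single_mul_single_same, Matrix.single_mul_single_of_ne _ _ _ _ hi,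
        Matrix.single_mul_single_of_ne _ _ _ _ hi', mul_one]
      module
  · simp [hij, Matrix.single_mul_single_of_ne _ _ _ _ (Ne.symm hij)]

lemma rootProj_mul_self (i₀ : Fin N) (x : Fin N × Fin N) :
    rootProj i₀ x * rootProj i₀ x = rootProj i₀ x := by
  obtain ⟨i, j⟩ := x
  unfold rootProj
  split_ifs with h
  · obtain ⟨-, hi⟩ := h
    have hi' : i₀ ≠ i := Ne.symm hi
    simp only [smul_mul_smul_comm, add_mul,
      mul_add, Matrix.single_mul_single_same, Matrix.single_mul_single_of_ne _ _ _ _ hi,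
      Matrix.single_mul_single_of_ne _ _ _ _ hi', mul_one]
    module
  · simp [Matrix.single_mul_single_same]

lemma star_rootProj (i₀ : Fin N) (x : Fin N × Fin N) :
    star (rootProj i₀ x) = rootProj i₀ x := by
  unfold rootProj
  split_ifs
  · simp only [star_smul, star_add, star_single, star_inv₀, star_ofNat]
    congr 1
    abel
  · exact star_single _ _

lemma trace_rootMatrix (i₀ : Fin N) (x : Fin N × Fin N) : (rootMatrix i₀ x).trace = 0 := by
  obtain ⟨i, j⟩ := x
  unfold rootMatrix
  split_ifs with h
  · by_cases hi : i = i₀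
    · subst hi; simp
    · have hi' : i₀ ≠ i := Ne.symm hi
      simp [Matrix.trace_single_eq_same, Matrix.trace_single_eq_of_ne, hi, hi']
  · simp only at h
    simp [Matrix.trace_single_eq_of_ne, h]

lemma exp_skewOf_mem {a : Matrix (Fin N) (Fin N) ℂ} (ha : a.trace = 0) (z : ℂ) :
    NormedSpace.exp (skewOf a z) ∈ Matrix.specialUnitaryGroup (Fin N) ℂ := by
  let _ : NormedAlgebra ℚ (Matrix (Fin N) (Fin N) ℂ) := NormedAlgebra.restrictScalars ℚ ℂ _
  refine Matrix.mem_specialUnitaryGroup_iff.2 ⟨NormedSpace.exp_mem_unitary_of_mem_skewAdjoint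
    (skewAdjoint.mem_iff.2 (star_skewOf a z)), ?_⟩
  rw [det_exp_of_conjTranspose_eq_neg (star_skewOf a z)]
  simp [skewOf, Matrix.trace_sub, Matrix.trace_smul, ha, Matrix.star_eq_conjTranspose,
    Matrix.trace_conjTranspose]

lemma sum_skewOf_rootMatrix (i₀ : Fin N) {V : Matrix (Fin N) (Fin N) ℂ} (hV : star V = -V)
    (htr : V.trace = 0) : ∑ x, skewOf (rootMatrix i₀ x) (V x.1 x.2) = V := by
  have hVc (i j : Fin N) : starRingEnd ℂ (V i j) = -V j i := by
    have := congrFun (congrFun hV j) i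
    simpa using this
  have h (i j : Fin N) : skewOf (rootMatrix i₀ (i, j)) (V i j) =
      (2 : ℂ)⁻¹ • Matrix.single i j (V i j) + (2 : ℂ)⁻¹ • Matrix.single j i (V j i) -
        if i = j then Matrix.single i₀ i₀ (V i i) else 0 := by
    have hs (k l m n : Fin N) : Matrix.single k l (V m n) = V m n • Matrix.single k l 1 := by
      simp [Matrix.smul_single]
    unfold skewOf rootMatrix
    rw [hVc, hs i j, hs j i, hs i₀ i₀]
    by_cases hij : i = j
    · subst hij
      simp only [if_true, star_smul, star_sub, star_add, star_single, star_inv₀, star_ofNat]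
      module
    · simp only [hij, if_false, star_smul, star_single, star_inv₀, star_ofNat]
      module
  rw [Fintype.sum_prod_type]
  simp only [h, Finset.sum_sub_distrib, Finset.sum_add_distrib, ← Finset.smul_sum,
    Finset.sum_ite_eq, Finset.mem_univ, if_true]
  rw [Finset.sum_comm (f := fun i j => Matrix.single j i (V j i)), ← Matrix.matrix_eq_sum_single V]
  have : ∑ i, Matrix.single i₀ i₀ (V i i) = 0 := by
    have h0 : ∑ i, V i i = 0 := htr
    simpa [h0] using (map_sum (Matrix.singleAddMonoidHom i₀ i₀) (fun i => V i i)
      Finset.univ).symm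
  rw [this]
  module

end Matrices

end LoopApprox

namespace LoopApprox

section Loops

open scoped Matrix.Norms.L2Operator ContDiff

variable {N : ℕ} {β : ℝ} {r : ℕ}

/-- Loops of special unitary matrices of class `LipClass β r`. -/
structure IsSULoop (β : ℝ) (r : ℕ) (U : ℝ → Matrix (Fin N) (Fin N) ℂ) : Prop where
  lip : ∀ i j, LipClass β r (fun t => U t i j)
  mem : ∀ t, U t ∈ Matrix.specialUnitaryGroup (Fin N) ℂ

lemma IsSULoop.const {g : Matrix (Fin N) (Fin N) ℂ}
    (hg : g ∈ Matrix.specialUnitaryGroup (Fin N) ℂ) : IsSULoop β r (fun _ => g) :=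
  ⟨fun i j => LipClass.const (g i j), fun _ => hg⟩

lemma lipClass_mul (hβ : 0 < β) (hβ1 : β ≤ 1) {U V : ℝ → Matrix (Fin N) (Fin N) ℂ}
    (hU : ∀ i j, LipClass β r (fun t => U t i j)) (hV : ∀ i j, LipClass β r (fun t => V t i j))
    (i j : Fin N) : LipClass β r (fun t => (U t * V t) i j) := by
  simp_rw [Matrix.mul_apply]
  exact LipClass.sum _ fun k _ => (hU i k).mul hβ hβ1 (hV k j)

lemma IsSULoop.mul (hβ : 0 < β) (hβ1 : β ≤ 1) {U V : ℝ → Matrix (Fin N) (Fin N) ℂ}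
    (hU : IsSULoop β r U) (hV : IsSULoop β r V) : IsSULoop β r (fun t => U t * V t) :=
  ⟨lipClass_mul hβ hβ1 hU.lip hV.lip, fun t => mul_mem (hU.mem t) (hV.mem t)⟩

lemma star_mem_specialUnitaryGroup {g : Matrix (Fin N) (Fin N) ℂ}
    (hg : g ∈ Matrix.specialUnitaryGroup (Fin N) ℂ) :
    star g ∈ Matrix.specialUnitaryGroup (Fin N) ℂ := by
  rw [Matrix.mem_specialUnitaryGroup_iff] at hg ⊢
  refine ⟨Unitary.star_mem hg.1, ?_⟩
  rw [Matrix.star_eq_conjTranspose, Matrix.det_conjTranspose, hg.2, star_one]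

lemma IsSULoop.star {U : ℝ → Matrix (Fin N) (Fin N) ℂ} (hU : IsSULoop β r U) :
    IsSULoop β r (fun t => star (U t)) :=
  ⟨fun i j => (hU.lip j i).conj, fun t => star_mem_specialUnitaryGroup (hU.mem t)⟩

lemma mul_star_of_mem {g : Matrix (Fin N) (Fin N) ℂ}
    (hg : g ∈ Matrix.specialUnitaryGroup (Fin N) ℂ) : g * star g = 1 :=
  Unitary.mul_star_self_of_mem (Matrix.mem_specialUnitaryGroup_iff.1 hg).1

lemma star_mul_of_mem {g : Matrix (Fin N) (Fin N) ℂ}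
    (hg : g ∈ Matrix.specialUnitaryGroup (Fin N) ℂ) : star g * g = 1 :=
  Unitary.star_mul_self_of_mem (Matrix.mem_specialUnitaryGroup_iff.1 hg).1

lemma IsSULoop.periodic {U : ℝ → Matrix (Fin N) (Fin N) ℂ} (hU : IsSULoop β r U) :
    Function.Periodic U (2 * π) := fun t => by
  ext i j
  exact (hU.lip i j).periodic t

/-- Special unitary loops close to the identity are approximable. -/
lemma exists_approximable_of_near_one (hβ : 0 < β) (hβ1 : β ≤ 1) (hα : 1 / 2 < r + β)
    (i₀ : Fin N) : ∃ δ : ℝ, 0 < δ ∧ ∀ W : ℝ → Matrix (Fin N) (Fin N) ℂ, IsSULoop β r W →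
      (∀ t, ‖W t - 1‖ < δ) →
      Approximable (r + β) (Matrix.specialUnitaryGroup (Fin N) ℂ) W := by
  obtain ⟨η, hη, htrace⟩ : ∃ η : ℝ, 0 < η ∧ ∀ V : Matrix (Fin N) (Fin N) ℂ, ‖V‖ < η →
      ‖V.trace‖ < 2 * π := by
    have h1 : Continuous fun V : Matrix (Fin N) (Fin N) ℂ => ‖V.trace‖ :=
      (Continuous.matrix_trace continuous_id).norm
    have h2 := (h1.tendsto 0).eventually_lt_const (u := 2 * π) (by
      rw [Matrix.trace_zero, norm_zero]
      exact Real.two_pi_pos)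
    obtain ⟨η, hη, h⟩ := Metric.eventually_nhds_iff.1 h2
    exact ⟨η, hη, fun V hV => h (by simpa using hV)⟩
  obtain ⟨δ, hδ, L, hL, hLW⟩ := exists_logarithm (A := Matrix (Fin N) (Fin N) ℂ) hη
  refine ⟨δ, hδ, fun W hW hW1 => ?_⟩
  have hWb (t : ℝ) : W t ∈ Metric.ball 1 δ := by
    rw [Metric.mem_ball, dist_eq_norm]; exact hW1 t
  have hWlip : LipClass β r W := by
    have h1 : W = fun t => ∑ i, ∑ j, ((ContinuousLinearMap.smulRight
        (ContinuousLinearMap.id ℂ ℂ) (Matrix.single i j (1 : ℂ))).restrictScalars ℝ :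
          ℂ →L[ℝ] Matrix (Fin N) (Fin N) ℂ) (W t i j) := by
      funext t
      conv_lhs => rw [Matrix.matrix_eq_sum_single (W t)]
      simp
    rw [h1]
    exact LipClass.sum _ fun i _ => LipClass.sum _ fun j _ => (hW.lip i j).clm_comp _
  have hVlip : LipClass β r (fun t => L (W t)) :=
    hWlip.comp_contDiffOn hβ hβ1 Metric.isOpen_ball hL hWb
  have hVij (x : Fin N × Fin N) : LipClass β r (fun t => L (W t) x.1 x.2) :=
    hVlip.clm_comp ((LinearMap.toContinuousLinearMap
      (Matrix.entryLinearMap ℂ ℂ x.1 x.2)).restrictScalars ℝ)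
  have hVs (t : ℝ) : star (L (W t)) = -L (W t) :=
    (hLW _ (hWb t)).2.2 (Matrix.mem_specialUnitaryGroup_iff.1 (hW.mem t)).1
  have hVtr (t : ℝ) : (L (W t)).trace = 0 := by
    have h1 := det_exp_of_conjTranspose_eq_neg (hVs t)
    rw [(hLW _ (hWb t)).1, (Matrix.mem_specialUnitaryGroup_iff.1 (hW.mem t)).2] at h1
    obtain ⟨n, hn⟩ := Complex.exp_eq_one_iff.1 h1.symm
    have h2 := htrace _ (hLW _ (hWb t)).2.1
    rw [hn] at h2 ⊢
    have h3 : ‖(n : ℂ) * (2 * π * Complex.I)‖ = |(n : ℝ)| * (2 * π) := by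
      simp [abs_of_pos Real.pi_pos]
    rw [h3] at h2
    have h4 : |(n : ℝ)| < 1 := by
      by_contra h
      push Not at h
      nlinarith [Real.pi_pos]
    have h5 : n = 0 := by
      rw [← Int.cast_abs] at h4
      exact Int.abs_lt_one_iff.1 (by exact_mod_cast h4)
    simp [h5]
  have := approximable_exp hβ hβ1 hα (Finset.univ : Finset (Fin N × Fin N))
    (rootProj_mul_rootMatrix i₀) (rootMatrix_mul_rootProj i₀) (rootProj_mul_self i₀)
    (star_rootProj i₀) (Matrix.specialUnitaryGroup (Fin N) ℂ)
    (fun g hg => norm_le_one_of_mem_specialUnitaryGroup hg)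
    (fun x => exp_skewOf_mem (trace_rootMatrix i₀ x)) hVij
  convert this using 2 with t
  rw [sum_skewOf_rootMatrix i₀ (hVs t) (hVtr t), (hLW _ (hWb t)).1]

/-- A homotopy of special unitary loops to the constant loop `1` gives approximability. -/
lemma approximable_of_homotopy (hβ : 0 < β) (hβ1 : β ≤ 1) (hα : 1 / 2 < r + β) (i₀ : Fin N)
    {H : ℝ → ℝ → Matrix (Fin N) (Fin N) ℂ}
    (hHc : ∀ i j, ContinuousOn (fun p : ℝ × ℝ => H p.1 p.2 i j) (Set.Icc 0 1 ×ˢ Set.univ))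
    (hH : ∀ s ∈ Set.Icc (0 : ℝ) 1, IsSULoop β r (H s)) (h1 : ∀ t, H 1 t = 1) :
    Approximable (r + β) (Matrix.specialUnitaryGroup (Fin N) ℂ) (H 0) := by
  obtain ⟨δ, hδ, hnear⟩ := exists_approximable_of_near_one (N := N) hβ hβ1 hα i₀
  have hc : ContinuousOn (fun p : ℝ × ℝ => H p.1 p.2) (Set.Icc 0 1 ×ˢ Set.Icc 0 (2 * π)) :=
    (continuousOn_pi.2 fun i => continuousOn_pi.2 fun j => hHc i j).mono
      (Set.prod_mono_right (Set.subset_univ _))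
  obtain ⟨ε, hε, hu⟩ := Metric.uniformContinuousOn_iff.1
    ((isCompact_Icc.prod isCompact_Icc).uniformContinuousOn_of_continuous hc) δ hδ
  obtain ⟨n, hn⟩ := exists_nat_one_div_lt hε
  have hn0 : (0 : ℝ) < n + 1 := by positivity
  have hstep (s s' : ℝ) (hs : s ∈ Set.Icc (0 : ℝ) 1) (hs' : s' ∈ Set.Icc (0 : ℝ) 1)
      (hss : |s - s'| < ε) (t : ℝ) : ‖H s t * star (H s' t) - 1‖ < δ := by
    have h2 : H s t * star (H s' t) - 1 = (H s t - H s' t) * star (H s' t) := by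
      rw [sub_mul, mul_star_of_mem ((hH s' hs').mem t)]
    rw [h2]
    refine (norm_mul_le _ _).trans_lt ?_
    refine (mul_le_of_le_one_right (norm_nonneg _) (norm_le_one_of_mem_specialUnitaryGroup
      (star_mem_specialUnitaryGroup ((hH s' hs').mem t)))).trans_lt ?_
    obtain ⟨t', ht', hst⟩ := ((hH s hs).periodic.sub (hH s' hs').periodic).exists_mem_Ico₀
      Real.two_pi_pos t
    have h3 : H s t - H s' t = H s t' - H s' t' := hst
    rw [h3, ← dist_eq_norm]
    have ht2 : t' ∈ Set.Icc 0 (2 * π) := Set.Ico_subset_Icc_self ht'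
    refine hu (s, t') ⟨hs, ht2⟩ (s', t') ⟨hs', ht2⟩ ?_
    rw [Prod.dist_eq]
    simpa [Real.dist_eq, hε] using hss
  have key (k : ℕ) (hk : k ≤ n + 1) : Approximable (r + β) (Matrix.specialUnitaryGroup (Fin N) ℂ)
      (H (1 - k / (n + 1))) := by
    have hmem (k : ℕ) (hk : k ≤ n + 1) : (1 - k / (n + 1) : ℝ) ∈ Set.Icc (0 : ℝ) 1 := by
      have : (k : ℝ) ≤ n + 1 := by exact_mod_cast hk
      have h2 : (k : ℝ) / (n + 1) ≤ 1 := (div_le_one hn0).2 this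
      have h3 : (0 : ℝ) ≤ (k : ℝ) / (n + 1) := by positivity
      exact ⟨by linarith, by linarith⟩
    induction k with
    | zero =>
      have : H (1 - ((0 : ℕ) : ℝ) / (n + 1)) = fun _ => 1 := by
        funext t
        simpa using h1 t
      rw [this]
      exact Approximable.const (one_mem _)
    | succ k ih =>
      have hk' : k ≤ n + 1 := by omega
      have hA := hH _ (hmem _ hk)
      have hB := hH _ (hmem _ hk')
      have hW := hA.mul hβ hβ1 hB.star
      have := (hnear _ hW (hstep _ _ (hmem _ hk) (hmem _ hk') ?_)).mul
        (fun g hg => norm_le_one_of_mem_specialUnitaryGroup hg) (ih hk') hW.mem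
      · convert this using 2 with t
        rw [mul_assoc, star_mul_of_mem (hB.mem t), mul_one]
      · have : (1 - ((k + 1 : ℕ) : ℝ) / (n + 1)) - (1 - (k : ℝ) / (n + 1)) = -(1 / (n + 1)) := by
          push_cast
          field_simp
          ring
        rw [this, abs_neg, abs_of_pos (by positivity)]
        exact hn
  have := key (n + 1) le_rfl
  rwa [show (1 - ((n + 1 : ℕ) : ℝ) / (n + 1)) = 0 by
    push_cast; rw [div_self hn0.ne', sub_self]] at this

end Loops

end LoopApprox

namespace LoopApprox

section Columns

open scoped Matrix.Norms.L2Operator ContDiff ComplexConjugate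

variable {N : ℕ} {β : ℝ} {r : ℕ} {k k' : Fin N}

/-- A complex reflection along `w`, normalised to have determinant one. -/
noncomputable def reflMatrix (k k' : Fin N) (w : Fin N → ℂ) (d : ℂ) :
    Matrix (Fin N) (Fin N) ℂ :=
  (1 - d⁻¹ • Matrix.vecMulVec w (star w)) *
    Matrix.diagonal (fun i => if i = k then -1 else if i = k' then d * (conj d)⁻¹ else 1)

lemma reflMatrix_apply (k k' : Fin N) (w : Fin N → ℂ) (d : ℂ) (i j : Fin N) :
    reflMatrix k k' w d i j = ((1 : Matrix (Fin N) (Fin N) ℂ) i j - d⁻¹ * (w i * conj (w j))) *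
      (if j = k then -1 else if j = k' then d * (conj d)⁻¹ else 1) := by
  simp [reflMatrix, Matrix.mul_diagonal, Matrix.vecMulVec_apply]

lemma reflMatrix_mem (hk : k' ≠ k) {w : Fin N → ℂ} {d : ℂ} (hd : d ≠ 0)
    (h : d + conj d = star w ⬝ᵥ w) :
    reflMatrix k k' w d ∈ Matrix.specialUnitaryGroup (Fin N) ℂ := by
  have hd' : conj d ≠ 0 := by simpa using hd
  set P := Matrix.vecMulVec w (star w) with hP
  have hPP : P * P = (d + conj d) • P := by
    rw [hP, Matrix.vecMulVec_mul_vecMulVec, h]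
    ext i j
    simp [Matrix.vecMulVec_apply, mul_left_comm]
  have hPs : star P = P := by
    ext i j
    simp [hP, Matrix.vecMulVec_apply, mul_comm]
  have hu : (1 - d⁻¹ • P) ∈ Matrix.unitaryGroup (Fin N) ℂ := by
    rw [Matrix.mem_unitaryGroup_iff, star_sub, star_smul, hPs, star_one, mul_sub, mul_one,
      sub_mul, one_mul, smul_mul_smul_comm, hPP, smul_smul]
    have : d⁻¹ * star d⁻¹ * (d + conj d) = d⁻¹ + star d⁻¹ := by
      simp only [RCLike.star_def, map_inv₀]
      field_simp
      ring
    rw [this, add_smul]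
    abel
  have hD : Matrix.diagonal (fun i => if i = k then -1 else if i = k' then d * (conj d)⁻¹ else 1) ∈
      Matrix.unitaryGroup (Fin N) ℂ := by
    rw [Matrix.mem_unitaryGroup_iff, Matrix.star_eq_conjTranspose, Matrix.diagonal_conjTranspose,
      Matrix.diagonal_mul_diagonal, ← Matrix.diagonal_one]
    congr 1
    funext i
    simp only [Pi.star_apply, RCLike.star_def]
    split_ifs
    · simp
    · simp only [map_mul, map_inv₀, Complex.conj_conj]
      field_simp
    · simp
  rw [Matrix.mem_specialUnitaryGroup_iff]
  refine ⟨mul_mem hu hD, ?_⟩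
  have h1 : (1 - d⁻¹ • P).det = 1 - d⁻¹ * (d + conj d) := by
    rw [h, hP, sub_eq_add_neg, ← neg_smul, ← Matrix.smul_vecMulVec,
      Matrix.vecMulVec_eq Unit, Matrix.det_one_add_replicateCol_mul_replicateRow,
      dotProduct_smul, smul_eq_mul]
    ring
  rw [reflMatrix, Matrix.det_mul, h1, Matrix.det_diagonal, Finset.prod_ite, Finset.prod_ite]
  have h2 : (Finset.univ.filter fun i => i = k) = {k} := by ext; simp
  have h3 : ((Finset.univ.filter fun i => ¬ i = k).filter fun i => i = k') = {k'} := by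
    ext i
    simp only [Finset.mem_filter, Finset.mem_univ, true_and, Finset.mem_singleton]
    exact ⟨fun h => h.2, fun h => ⟨h ▸ hk, h⟩⟩
  rw [h2, h3]
  simp
  field_simp
  ring

/-- A homotopy, through special unitary matrices, from a matrix with `k`-th column `u` to `1`. -/
noncomputable def colHomotopy (k k' : Fin N) (u : Fin N → ℂ) (s : ℝ) :
    Matrix (Fin N) (Fin N) ℂ :=
  reflMatrix k k' (fun i => (1 - s) * u i + (1 + s) * (1 : Matrix (Fin N) (Fin N) ℂ) i k)
    (1 + s ^ 2 + (1 - s ^ 2) * ((u k + conj (u k)) / 2) - (1 - s) * ((u k - conj (u k)) / 2))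

lemma neg_one_lt_re {u : Fin N → ℂ} (hu : star u ⬝ᵥ u = 1) (huk : u k ≠ -1) :
    -1 < (u k).re := by
  have h1 : ∑ i, Complex.normSq (u i) = 1 := by
    have : ((∑ i, Complex.normSq (u i) : ℝ) : ℂ) = 1 := by
      rw [← hu]
      push_cast
      exact Finset.sum_congr rfl fun i _ => Complex.normSq_eq_conj_mul_self
    exact_mod_cast this
  have h2 : Complex.normSq (u k) ≤ 1 := by
    rw [← h1]
    exact Finset.single_le_sum (f := fun i => Complex.normSq (u i))
      (fun i _ => Complex.normSq_nonneg _) (Finset.mem_univ k)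
  rw [Complex.normSq_apply] at h2
  by_contra h
  push Not at h
  refine huk (Complex.ext ?_ ?_)
  · simp only [Complex.neg_re, Complex.one_re]
    nlinarith [mul_self_nonneg (u k).im]
  · simp only [Complex.neg_im, Complex.one_im, neg_zero]
    nlinarith [mul_self_nonneg (u k).im]

lemma colHomotopy_denom_ne_zero {u : Fin N → ℂ} (hu : star u ⬝ᵥ u = 1) (huk : u k ≠ -1) {s : ℝ}
    (hs : s ∈ Set.Icc (0 : ℝ) 1) :
    (1 + s ^ 2 + (1 - s ^ 2) * ((u k + conj (u k)) / 2) -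
      (1 - s) * ((u k - conj (u k)) / 2) : ℂ) ≠ 0 := by
  intro h
  have h1 := congrArg Complex.re h
  rw [Complex.add_conj, Complex.sub_conj] at h1
  have h2 : 1 + s ^ 2 + (1 - s ^ 2) * (u k).re = 0 := by
    simpa [← Complex.ofReal_pow, ← Complex.ofReal_one, ← Complex.ofReal_sub] using h1
  have h3 := neg_one_lt_re hu huk
  obtain ⟨h0, h1⟩ := hs
  rcases h0.eq_or_lt with h0 | h0
  · subst h0
    linarith
  · nlinarith [mul_nonneg (show 0 ≤ 1 - s ^ 2 by nlinarith) (show 0 ≤ 1 + (u k).re by linarith)]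

lemma colHomotopy_mem (hk : k' ≠ k) {u : Fin N → ℂ} (hu : star u ⬝ᵥ u = 1) (huk : u k ≠ -1)
    {s : ℝ} (hs : s ∈ Set.Icc (0 : ℝ) 1) :
    colHomotopy k k' u s ∈ Matrix.specialUnitaryGroup (Fin N) ℂ := by
  refine reflMatrix_mem hk (colHomotopy_denom_ne_zero hu huk hs) ?_
  have h1 : star (fun i => (1 - s) * u i + (1 + s) * (1 : Matrix (Fin N) (Fin N) ℂ) i k) ⬝ᵥ
      (fun i => (1 - s) * u i + (1 + s) * (1 : Matrix (Fin N) (Fin N) ℂ) i k) =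
      (1 - s) ^ 2 * (star u ⬝ᵥ u) + (1 - s) * (1 + s) * (u k + conj (u k)) + (1 + s) ^ 2 := by
    have h2 (i : Fin N) : conj ((1 - s) * u i + (1 + s) * (1 : Matrix (Fin N) (Fin N) ℂ) i k) *
        ((1 - s) * u i + (1 + s) * (1 : Matrix (Fin N) (Fin N) ℂ) i k) =
        (1 - s) ^ 2 * (conj (u i) * u i) +
          if i = k then (1 - s) * (1 + s) * (u i + conj (u i)) + (1 + s) ^ 2 else 0 := by
      by_cases hik : i = k
      · subst hik
        simp only [Matrix.one_apply_eq, if_true, map_add, map_mul, map_sub, map_one,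
          Complex.conj_ofReal]
        ring
      · simp [hik]; ring
    simp only [dotProduct, Pi.star_apply, RCLike.star_def, h2, Finset.sum_add_distrib,
      ← Finset.mul_sum, Finset.sum_ite_eq', Finset.mem_univ, if_true]
    ring
  rw [h1, hu]
  simp only [map_sub, map_add, map_mul, map_pow, map_one, Complex.conj_ofReal, map_div₀,
    Complex.conj_conj, map_ofNat]
  ring

lemma colHomotopy_one (hk : k' ≠ k) (u : Fin N → ℂ) : colHomotopy k k' u 1 = 1 := by
  ext i j
  rw [colHomotopy, reflMatrix_apply]
  by_cases hj : j = k
  · subst hj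
    by_cases hi : i = j
    · subst hi
      simp
    · simp [hi]
  · by_cases hj' : j = k'
    · subst hj'
      simp [hj]
    · simp [hj, hj']

lemma colHomotopy_zero_col (u : Fin N → ℂ) (huk : u k ≠ -1) (i : Fin N) :
    colHomotopy k k' u 0 i k = u i := by
  have h0 : 1 + conj (u k) ≠ 0 := fun h => huk <| by
    have := congrArg conj (eq_neg_of_add_eq_zero_right h)
    simpa using this
  rw [colHomotopy, reflMatrix_apply]
  have h1 : (1 + (0 : ℝ) ^ 2 + (1 - (0 : ℝ) ^ 2) * ((u k + conj (u k)) / 2) -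
      (1 - (0 : ℝ)) * ((u k - conj (u k)) / 2) : ℂ) = 1 + conj (u k) := by
    push_cast; ring
  rw [h1]
  simp only [Complex.ofReal_zero, sub_zero, one_mul, add_zero, Matrix.one_apply_eq, map_add,
    map_one, if_true]
  field_simp
  ring

lemma colHomotopy_col_of_eq_zero {u : Fin N → ℂ} {j : Fin N} (hj : j ≠ k) (hj' : j ≠ k')
    (huj : u j = 0) (s : ℝ) (i : Fin N) :
    colHomotopy k k' u s i j = (1 : Matrix (Fin N) (Fin N) ℂ) i j := by
  rw [colHomotopy, reflMatrix_apply]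
  simp [hj, hj', huj]

lemma LipClass.const_mul {f : ℝ → ℂ} (hβ : 0 < β) (hβ1 : β ≤ 1) (c : ℂ) (hf : LipClass β r f) :
    LipClass β r (fun t => c * f t) :=
  (LipClass.const c).mul hβ hβ1 hf

lemma isSULoop_colHomotopy (hβ : 0 < β) (hβ1 : β ≤ 1) (hk : k' ≠ k) {u : ℝ → Fin N → ℂ}
    (hul : ∀ i, LipClass β r (fun t => u t i)) (hu : ∀ t, star (u t) ⬝ᵥ u t = 1)
    (huk : ∀ t, u t k ≠ -1) {s : ℝ} (hs : s ∈ Set.Icc (0 : ℝ) 1) :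
    IsSULoop β r (fun t => colHomotopy k k' (u t) s) := by
  refine ⟨fun i j => ?_, fun t => colHomotopy_mem hk (hu t) (huk t) hs⟩
  simp only [colHomotopy, reflMatrix_apply]
  have hw (i : Fin N) : LipClass β r
      (fun t => (1 - s) * u t i + (1 + s) * (1 : Matrix (Fin N) (Fin N) ℂ) i k) :=
    ((hul i).const_mul hβ hβ1 _).add (LipClass.const _)
  have hd : LipClass β r (fun t => (1 + s ^ 2 + (1 - s ^ 2) * ((u t k + conj (u t k)) / 2) -
      (1 - s) * ((u t k - conj (u t k)) / 2) : ℂ)) := by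
    simp only [div_eq_mul_inv]
    exact ((LipClass.const _).add ((((hul k).add (hul k).conj).mul hβ hβ1
      (LipClass.const _)).const_mul hβ hβ1 _)).sub ((((hul k).sub (hul k).conj).mul hβ hβ1
      (LipClass.const _)).const_mul hβ hβ1 _)
  have hd0 (t : ℝ) := colHomotopy_denom_ne_zero (hu t) (huk t) hs
  refine LipClass.mul hβ hβ1 ((LipClass.const _).sub ((hd.inv hβ hβ1 hd0).mul hβ hβ1
    ((hw i).mul hβ hβ1 (hw j).conj))) ?_
  split_ifs
  · exact LipClass.const _
  · exact hd.mul hβ hβ1 (hd.conj.inv hβ hβ1 fun t => by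
      rw [ne_eq, map_eq_zero]
      exact hd0 t)
  · exact LipClass.const _

lemma approximable_colHomotopy (hβ : 0 < β) (hβ1 : β ≤ 1) (hα : 1 / 2 < r + β) (hk : k' ≠ k)
    {u : ℝ → Fin N → ℂ}
    (hul : ∀ i, LipClass β r (fun t => u t i)) (hu : ∀ t, star (u t) ⬝ᵥ u t = 1)
    (huk : ∀ t, u t k ≠ -1) :
    Approximable (r + β) (Matrix.specialUnitaryGroup (Fin N) ℂ)
      (fun t => colHomotopy k k' (u t) 0) := by
  refine approximable_of_homotopy hβ hβ1 hα k (H := fun s t => colHomotopy k k' (u t) s)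
    (fun i j => ?_) (fun s hs => isSULoop_colHomotopy hβ hβ1 hk hul hu huk hs)
    (fun t => colHomotopy_one hk (u t))
  simp only [colHomotopy, reflMatrix_apply]
  have hc (i : Fin N) : Continuous (fun p : ℝ × ℝ => u p.2 i) :=
    ((hul i).continuous hβ).comp continuous_snd
  have hd : Continuous (fun p : ℝ × ℝ => (1 + (p.1 : ℂ) ^ 2 + (1 - (p.1 : ℂ) ^ 2) *
      ((u p.2 k + conj (u p.2 k)) / 2) - (1 - p.1) * ((u p.2 k - conj (u p.2 k)) / 2) : ℂ)) := by
    have h1 := hc k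
    have h2 : Continuous (fun p : ℝ × ℝ => conj (u p.2 k)) := Complex.continuous_conj.comp h1
    have h3 : Continuous (fun p : ℝ × ℝ => (p.1 : ℂ)) :=
      Complex.continuous_ofReal.comp continuous_fst
    exact ((continuous_const.add (h3.pow 2)).add ((continuous_const.sub (h3.pow 2)).mul
      ((h1.add h2).div_const 2))).sub ((continuous_const.sub h3).mul ((h1.sub h2).div_const 2))
  have hd0 (p : ℝ × ℝ) (hp : p ∈ Set.Icc (0 : ℝ) 1 ×ˢ (Set.univ : Set ℝ)) :=
    colHomotopy_denom_ne_zero (hu p.2) (huk p.2) hp.1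
  have hi := hd.continuousOn.inv₀ hd0
  refine ContinuousOn.mul (continuousOn_const.sub (hi.mul (Continuous.continuousOn ?_))) ?_
  · have hw (i : Fin N) : Continuous (fun p : ℝ × ℝ =>
        (1 - (p.1 : ℂ)) * u p.2 i + (1 + (p.1 : ℂ)) * (1 : Matrix (Fin N) (Fin N) ℂ) i k) := by
      have h1 := hc i
      have h3 : Continuous (fun p : ℝ × ℝ => (p.1 : ℂ)) :=
        Complex.continuous_ofReal.comp continuous_fst
      exact ((continuous_const.sub h3).mul h1).add ((continuous_const.add h3).mul continuous_const)
    exact (hw i).mul (Complex.continuous_conj.comp (hw j))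
  · split_ifs
    · exact continuousOn_const
    · exact hd.continuousOn.mul ((Complex.continuous_conj.comp hd).continuousOn.inv₀ fun p hp => by
        simp only [Function.comp_apply, ne_eq, map_eq_zero]
        exact hd0 p hp)
    · exact continuousOn_const

end Columns

end LoopApprox

namespace LoopApprox

section Factorisation

open scoped Matrix.Norms.L2Operator

variable {N : ℕ} {β : ℝ} {r : ℕ}

lemma star_dotProduct_col {V : Matrix (Fin N) (Fin N) ℂ}
    (hV : V ∈ Matrix.specialUnitaryGroup (Fin N) ℂ) (j k : Fin N) :
    star (fun i => V i j) ⬝ᵥ (fun i => V i k) = (1 : Matrix (Fin N) (Fin N) ℂ) j k := by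
  rw [← star_mul_of_mem hV]
  simp [Matrix.mul_apply, dotProduct]

lemma apply_eq_zero_of_col {V : Matrix (Fin N) (Fin N) ℂ}
    (hV : V ∈ Matrix.specialUnitaryGroup (Fin N) ℂ) {j k : Fin N} (hjk : j ≠ k)
    (hj : ∀ i, V i j = (1 : Matrix (Fin N) (Fin N) ℂ) i j) : V j k = 0 := by
  have h := star_dotProduct_col hV j k
  simp only [hj, dotProduct, Pi.star_apply, Matrix.one_apply_ne hjk] at h
  rw [Finset.sum_eq_single j (fun i _ hi => by simp [Matrix.one_apply_ne hi])
    (fun h => absurd (Finset.mem_univ j) h)] at h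
  simpa using h

lemma eq_one_of_col {V : Matrix (Fin N) (Fin N) ℂ}
    (hV : V ∈ Matrix.specialUnitaryGroup (Fin N) ℂ) (l : Fin N)
    (h : ∀ j, j ≠ l → ∀ i, V i j = (1 : Matrix (Fin N) (Fin N) ℂ) i j) : V = 1 := by
  have hd : V = Matrix.diagonal (fun i => if i = l then V l l else 1) := by
    ext i j
    by_cases hj : j = l
    · subst hj
      by_cases hi : i = j
      · subst hi; simp
      · rw [apply_eq_zero_of_col hV hi (h i hi), Matrix.diagonal_apply_ne _ hi]
    · rw [h j hj i]
      by_cases hi : i = j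
      · subst hi; simp [hj]
      · rw [Matrix.one_apply_ne hi, Matrix.diagonal_apply_ne _ hi]
  have hdet := (Matrix.mem_specialUnitaryGroup_iff.1 hV).2
  rw [hd, Matrix.det_diagonal, Finset.prod_ite_eq' Finset.univ l, if_pos (Finset.mem_univ l)]
    at hdet
  rw [hd, hdet]
  simp

lemma apply_eq_zero_of_apply_eq_neg_one {V : Matrix (Fin N) (Fin N) ℂ}
    (hV : V ∈ Matrix.specialUnitaryGroup (Fin N) ℂ) {k l : Fin N} (hk : V k k = -1)
    (hl : l ≠ k) : V l k = 0 := by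
  have h1 : ∑ i, Complex.normSq (V i k) = 1 := by
    have h := star_dotProduct_col hV k k
    rw [Matrix.one_apply_eq] at h
    have : ((∑ i, Complex.normSq (V i k) : ℝ) : ℂ) = 1 := by
      rw [← h]
      push_cast
      exact Finset.sum_congr rfl fun i _ => Complex.normSq_eq_conj_mul_self
    exact_mod_cast this
  have h2 := Finset.add_sum_erase Finset.univ (fun i => Complex.normSq (V i k))
    (Finset.mem_univ k)
  rw [h1, hk] at h2
  have h3 : ∑ i ∈ Finset.univ.erase k, Complex.normSq (V i k) = 0 := by simpa using h2
  rw [Finset.sum_eq_zero_iff_of_nonneg fun i _ => Complex.normSq_nonneg _] at h3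
  exact Complex.normSq_eq_zero.1 (h3 l (by simp [hl]))

lemma exists_factorisation (hβ : 0 < β) (hβ1 : β ≤ 1) (hα : 1 / 2 < r + β) {k k' : Fin N}
    (hk : k < k') {U : ℝ → Matrix (Fin N) (Fin N) ℂ} (hU : IsSULoop β r U)
    (hUk : ∀ t j, j < k → ∀ i, U t i j = (1 : Matrix (Fin N) (Fin N) ℂ) i j) :
    ∃ R W : ℝ → Matrix (Fin N) (Fin N) ℂ,
      Approximable (r + β) (Matrix.specialUnitaryGroup (Fin N) ℂ) R ∧
      (∀ t, R t ∈ Matrix.specialUnitaryGroup (Fin N) ℂ) ∧ IsSULoop β r W ∧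
      (∀ t j, j ≤ k → ∀ i, W t i j = (1 : Matrix (Fin N) (Fin N) ℂ) i j) ∧
      ∀ t, U t = R t * W t := by
  have hkk : k' ≠ k := hk.ne'
  obtain ⟨z, hz, hzU⟩ := (hU.lip k k).exists_notMem_range hβ hα
  set y : ℝ := √(1 - ‖z‖ ^ 2) with hy
  have hy2 : y ^ 2 = 1 - ‖z‖ ^ 2 :=
    Real.sq_sqrt (by nlinarith [norm_nonneg z])
  set u₀ : Fin N → ℂ := fun i => if i = k then -z else if i = k' then (y : ℂ) else 0 with hu₀
  have hu₀k : u₀ k = -z := by simp [hu₀]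
  have hu₀u : star u₀ ⬝ᵥ u₀ = 1 := by
    have h1 (i : Fin N) : star (u₀ i) * u₀ i =
        (if i = k then (‖z‖ : ℂ) ^ 2 else 0) + if i = k' then (y : ℂ) ^ 2 else 0 := by
      by_cases hi : i = k
      · subst hi
        simp [hu₀, hkk.symm, Complex.conj_mul']
      · by_cases hi' : i = k'
        · subst hi'
          simp [hu₀, hi, sq]
        · simp [hu₀, hi, hi']
    simp only [dotProduct, Pi.star_apply, h1, Finset.sum_add_distrib, Finset.sum_ite_eq',
      Finset.mem_univ, if_true]
    rw [← Complex.ofReal_pow y, hy2]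
    push_cast
    ring
  have hu₀1 : u₀ k ≠ -1 := by
    rw [hu₀k]
    intro h
    rw [neg_inj.1 h, norm_one] at hz
    exact lt_irrefl _ hz
  have h0 : (0 : ℝ) ∈ Set.Icc (0 : ℝ) 1 := by simp
  set g := colHomotopy k k' u₀ 0 with hg
  have hgm : g ∈ Matrix.specialUnitaryGroup (Fin N) ℂ := colHomotopy_mem hkk hu₀u hu₀1 h0
  have hgcol (j : Fin N) (hj : j < k) (i : Fin N) :
      g i j = (1 : Matrix (Fin N) (Fin N) ℂ) i j :=
    colHomotopy_col_of_eq_zero hj.ne (hj.trans hk).ne (by simp [hu₀, hj.ne, (hj.trans hk).ne]) 0 i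
  have hgk : g k k = -z := by rw [hg, colHomotopy_zero_col u₀ hu₀1, hu₀k]
  clear_value g
  have hstar {A B : Matrix (Fin N) (Fin N) ℂ} (hA : A ∈ Matrix.specialUnitaryGroup (Fin N) ℂ)
      {j : Fin N} (hAB : ∀ i, B i j = A i j) (i : Fin N) :
      (star A * B) i j = (1 : Matrix (Fin N) (Fin N) ℂ) i j := by
    rw [← star_mul_of_mem hA, Matrix.mul_apply, Matrix.mul_apply]
    simp only [hAB]
  set V : ℝ → Matrix (Fin N) (Fin N) ℂ := fun t => star g * U t with hV
  have hVS : IsSULoop β r V := (IsSULoop.const (star_mem_specialUnitaryGroup hgm)).mul hβ hβ1 hU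
  have hUV (t : ℝ) : U t = g * V t := by
    rw [hV, ← mul_assoc, mul_star_of_mem hgm, one_mul]
  have hVcol (t : ℝ) (j : Fin N) (hj : j < k) :
      ∀ i, V t i j = (1 : Matrix (Fin N) (Fin N) ℂ) i j :=
    hstar hgm fun i => by rw [hUk t j hj i, hgcol j hj i]
  clear_value V
  have hVu (t : ℝ) : star (fun i => V t i k) ⬝ᵥ (fun i => V t i k) = 1 := by
    rw [star_dotProduct_col (hVS.mem t), Matrix.one_apply_eq]
  have hVk (t : ℝ) : V t k k ≠ -1 := by
    intro h
    refine hzU t ?_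
    rw [hUV t, Matrix.mul_apply, Finset.sum_eq_single k (fun l _ hl => by
      rw [apply_eq_zero_of_apply_eq_neg_one (hVS.mem t) h hl, mul_zero])
      (fun h => absurd (Finset.mem_univ k) h), h, hgk]
    ring
  set R : ℝ → Matrix (Fin N) (Fin N) ℂ := fun t => colHomotopy k k' (fun i => V t i k) 0 with hR
  have hRS : IsSULoop β r R :=
    isSULoop_colHomotopy hβ hβ1 hkk (fun i => hVS.lip i k) hVu hVk h0
  have hRA : Approximable (r + β) (Matrix.specialUnitaryGroup (Fin N) ℂ) R :=
    approximable_colHomotopy hβ hβ1 hα hkk (fun i => hVS.lip i k) hVu hVk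
  have hRk (t : ℝ) (i : Fin N) : V t i k = R t i k :=
    (colHomotopy_zero_col (fun i => V t i k) (hVk t) i).symm
  have hRcol (t : ℝ) (j : Fin N) (hj : j < k) (i : Fin N) : V t i j = R t i j := by
    rw [hVcol t j hj i]
    exact (colHomotopy_col_of_eq_zero (u := fun i => V t i k) hj.ne (hj.trans hk).ne
      (apply_eq_zero_of_col (hVS.mem t) hj.ne (hVcol t j hj)) 0 i).symm
  clear_value R
  refine ⟨fun t => g * R t, fun t => star (R t) * V t, (Approximable.const hgm).mul
    (fun g hg => norm_le_one_of_mem_specialUnitaryGroup hg) hRA fun _ => hgm,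
    fun t => mul_mem hgm (hRS.mem t), hRS.star.mul hβ hβ1 hVS, fun t j hj => ?_, fun t => ?_⟩
  · refine hstar (hRS.mem t) fun i => ?_
    rcases hj.eq_or_lt with rfl | hj
    · exact hRk t i
    · exact hRcol t j hj i
  · change U t = g * R t * (star (R t) * V t)
    rw [mul_assoc, ← mul_assoc (R t), mul_star_of_mem (hRS.mem t), one_mul]
    exact hUV t

/-- Every special unitary loop is approximable. -/
lemma IsSULoop.approximable (hβ : 0 < β) (hβ1 : β ≤ 1) (hα : 1 / 2 < r + β) (hN : 0 < N)
    {U : ℝ → Matrix (Fin N) (Fin N) ℂ} (hU : IsSULoop β r U) :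
    Approximable (r + β) (Matrix.specialUnitaryGroup (Fin N) ℂ) U := by
  have key (m k : ℕ) (hm : k + 1 + m = N) (U : ℝ → Matrix (Fin N) (Fin N) ℂ)
      (hU : IsSULoop β r U)
      (hUk : ∀ t, ∀ j : Fin N, (j : ℕ) < k → ∀ i,
        U t i j = (1 : Matrix (Fin N) (Fin N) ℂ) i j) :
      Approximable (r + β) (Matrix.specialUnitaryGroup (Fin N) ℂ) U := by
    induction m generalizing k U with
    | zero =>
      have : U = fun _ => 1 := by
        funext t
        refine eq_one_of_col (hU.mem t) ⟨k, by omega⟩ fun j hj => hUk t j ?_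
        have h1 := j.2
        have h2 : (j : ℕ) ≠ k := fun h => hj (Fin.ext h)
        omega
      rw [this]
      exact Approximable.const (one_mem _)
    | succ m ih =>
      obtain ⟨R, W, hR, hRm, hW, hWk, h⟩ := exists_factorisation hβ hβ1 hα
        (k := ⟨k, by omega⟩) (k' := ⟨k + 1, by omega⟩) (by simp) hU (fun t j hj => hUk t j hj)
      rw [show U = fun t => R t * W t from funext h]
      exact hR.mul (fun g hg => norm_le_one_of_mem_specialUnitaryGroup hg)
        (ih (k + 1) (by omega) W hW fun t j hj => hWk t j (Nat.lt_succ_iff.1 hj)) hRm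
  exact key (N - 1) 0 (by omega) U hU fun t j hj => absurd hj (Nat.not_lt_zero _)

end Factorisation

end LoopApprox

namespace LoopApprox

section Conversion

variable {N : ℕ}

lemma norm_apply_le_specNorm (A : Matrix (Fin N) (Fin N) ℂ) (i j : Fin N) :
    ‖A i j‖ ≤ specNorm A := by
  have h1 : (Matrix.toEuclideanCLM (𝕜 := ℂ) A (EuclideanSpace.single j 1)) i = A i j := by
    simp [EuclideanSpace.single]
  rw [← h1]
  refine (PiLp.norm_apply_le _ i).trans ((ContinuousLinearMap.le_opNorm _ _).trans_eq ?_)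
  simp [specNorm]

lemma lipClass_of_contDiff {E F : Type*} [NormedAddCommGroup E] [NormedSpace ℝ E]
    [NormedAddCommGroup F] [NormedSpace ℝ F] {β C : ℝ} {r : ℕ} {f : ℝ → E} (L : E →L[ℝ] F)
    (hf : ContDiff ℝ r f) (hper : Function.Periodic f (2 * π))
    (hC : ∀ s t : ℝ, ‖L (iteratedDeriv r f t - iteratedDeriv r f s)‖ ≤ C * |t - s| ^ β) :
    LipClass β r (fun t => L (f t)) := by
  have hLper {g : ℝ → E} (hg : Function.Periodic g (2 * π)) :
      Function.Periodic (fun t => L (g t)) (2 * π) := fun t => congrArg L (hg t)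
  induction r generalizing f with
  | zero => exact ⟨hLper hper, C, by simpa using hC⟩
  | succ r ih =>
    have hf' := contDiff_succ_iff_deriv.1 (show ContDiff ℝ ((r : WithTop ℕ∞) + 1) f by simpa using hf)
    refine ⟨hLper hper, fun t => L.differentiableAt.comp t (hf'.1 t), ?_⟩
    have h1 : deriv (fun t => L (f t)) = fun t => L (deriv f t) := by
      funext t
      exact (L.hasFDerivAt.comp_hasDerivAt t (hf'.1 t).hasDerivAt).deriv
    rw [h1]
    refine ih hf'.2.2 (periodic_deriv hper) ?_
    simpa only [iteratedDeriv_succ'] using hC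

lemma lipClass_of_memLip {α : ℝ} {U : ℝ → Matrix (Fin N) (Fin N) ℂ} (hU : MemLip α U)
    (hper : Function.Periodic U (2 * π)) (i j : Fin N) :
    LipClass (lipβ α) (lipR α) (fun t => U t i j) := by
  obtain ⟨hd, C, hC⟩ := hU
  refine lipClass_of_contDiff (C := C)
    (LinearMap.toContinuousLinearMap (Matrix.entryLinearMap ℝ ℂ i j)) (by exact_mod_cast hd) hper
    fun s t => ?_
  exact (norm_apply_le_specNorm _ i j).trans (hC s t)

lemma lipR_add_lipβ (α : ℝ) : (lipR α : ℝ) + lipβ α = α := by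
  simp [lipβ]

lemma lipR_cast {α : ℝ} (hα : 0 < α) : (lipR α : ℝ) = ⌈α⌉₊ - 1 := by
  rw [lipR, Nat.cast_sub (Nat.one_le_ceil_iff.2 hα), Nat.cast_one]

lemma lipβ_pos {α : ℝ} (hα : 0 < α) : 0 < lipβ α := by
  rw [lipβ, lipR_cast hα]
  linarith [Nat.ceil_lt_add_one hα.le]

lemma lipβ_le_one {α : ℝ} (hα : 0 < α) : lipβ α ≤ 1 := by
  rw [lipβ, lipR_cast hα]
  linarith [Nat.le_ceil α]

end Conversion

section Degrees

variable {A : Type*} [CStarAlgebra A]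

/-- Approximation along the dyadic scale gives approximation for all degrees. -/
lemma Approximable.exists_forall_degree {α : ℝ} (hα : 0 < α) {G : Submonoid A}
    (hG : ∀ g ∈ G, ‖g‖ ≤ 1) {U : ℝ → A} (hUG : ∀ t, U t ∈ G) (hU : Approximable α G U) :
    ∃ C : ℝ, 0 < C ∧ ∀ n : ℕ, ∃ P : ℝ → A, IsTrigPoly n P ∧ (∀ t, P t ∈ G) ∧
      ∀ t, ‖U t - P t‖ ≤ C * ((n : ℝ) + 1) ^ (-(α / (1 + α))) := by
  obtain ⟨C, D, hC, hD, h⟩ := hU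
  set D' : ℝ := max D 1 with hD'
  have hD1 : 1 ≤ D' := le_max_right _ _
  set E : ℝ := D' * 2 ^ (1 + α) + 1 with hE
  have h2 : (1 : ℝ) ≤ 2 ^ (1 + α) := Real.one_le_rpow one_le_two (by linarith)
  have hE0 : 0 < E := by positivity
  set γ : ℝ := α / (1 + α) with hγ
  have hγ0 : 0 ≤ γ := by positivity
  refine ⟨(C + 2) * E ^ γ, by positivity, fun n => ?_⟩
  have hn0 : (0 : ℝ) < n + 1 := by positivity
  have hscale {x : ℝ} (hx : 0 < x) (hnx : (n : ℝ) + 1 ≤ E * x ^ (1 + α)) :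
      x ^ (-α) ≤ E ^ γ * ((n : ℝ) + 1) ^ (-γ) := by
    have h3 : (E * x ^ (1 + α)) ^ (-γ) ≤ ((n : ℝ) + 1) ^ (-γ) :=
      Real.rpow_le_rpow_of_nonpos hn0 hnx (by linarith)
    rw [Real.mul_rpow hE0.le (by positivity), ← Real.rpow_mul hx.le,
      show (1 + α) * -γ = -α by rw [hγ]; field_simp, Real.rpow_neg hE0.le,
      inv_mul_le_iff₀ (by positivity)] at h3
    exact h3
  have hex : ∃ j : ℕ, (n : ℝ) < D' * ((2 : ℝ) ^ j) ^ (1 + α) := by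
    refine ⟨n, ?_⟩
    have h3 : (n : ℝ) < 2 ^ n := by exact_mod_cast Nat.lt_two_pow_self
    have h4 : (2 : ℝ) ^ n ≤ ((2 : ℝ) ^ n) ^ (1 + α) :=
      Real.self_le_rpow_of_one_le (one_le_pow₀ one_le_two) (by linarith)
    nlinarith
  classical
  have hspec := Nat.find_spec hex
  rcases hm : Nat.find hex with _ | m
  · rw [hm] at hspec
    refine ⟨fun _ => 1, isTrigPoly_const _ _, fun _ => G.one_mem, fun t => ?_⟩
    have h3 := hscale one_pos (by
      rw [Real.one_rpow, mul_one]
      simp only [pow_zero, Real.one_rpow, mul_one] at hspec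
      nlinarith)
    rw [Real.one_rpow] at h3
    calc ‖U t - 1‖ ≤ 1 + 1 := (norm_sub_le _ _).trans
          (add_le_add (hG _ (hUG t)) (hG _ G.one_mem))
      _ ≤ (C + 2) * 1 := by linarith
      _ ≤ (C + 2) * (E ^ γ * ((n : ℝ) + 1) ^ (-γ)) := by gcongr
      _ = _ := by ring
  · rw [hm] at hspec
    have hmin := not_lt.1 (Nat.find_min hex (m := m) (by omega))
    obtain ⟨d, P, hP, hPG, hd, hUP⟩ := h m
    have hK1 : (1 : ℝ) ≤ 2 ^ m := one_le_pow₀ one_le_two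
    have hK : (1 : ℝ) ≤ ((2 : ℝ) ^ m) ^ (1 + α) := Real.one_le_rpow hK1 (by linarith)
    refine ⟨P, hP.mono ?_, hPG, fun t => (hUP t).trans ?_⟩
    · have : (d : ℝ) ≤ n := hd.trans (le_trans (by gcongr; exact le_max_left _ _) hmin)
      exact_mod_cast this
    · have h3 := hscale (x := 2 ^ m) (by positivity) (by
        rw [pow_succ, Real.mul_rpow (by positivity) (by positivity)] at hspec
        rw [hE]
        nlinarith)
      calc _ ≤ (C + 2) * (E ^ γ * ((n : ℝ) + 1) ^ (-γ)) := by gcongr; linarith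
        _ = _ := by ring

end Degrees

section SpecialUnitary

open scoped Matrix.Norms.L2Operator

lemma exists_isPolyLoop_approximation {N : ℕ} (hN : 0 < N) {α : ℝ} (hα : 1 / 2 < α)
    {U : ℝ → Matrix (Fin N) (Fin N) ℂ} (hUl : ∀ i j, LipClass (lipβ α) (lipR α) (fun t => U t i j))
    (hUsu : ∀ t : ℝ, U t ∈ SpecialUnitary N) :
    ∃ C : ℝ, 0 < C ∧ ∀ n : ℕ, ∃ P : ℝ → Matrix (Fin N) (Fin N) ℂ,
      IsPolyLoop n (SpecialUnitary N) P ∧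
        ∀ t, specNorm (U t - P t) ≤ C * ((n : ℝ) + 1) ^ (-(α / (1 + α))) := by
  have hα0 : 0 < α := by linarith
  have hU : IsSULoop (lipβ α) (lipR α) U :=
    ⟨hUl, fun t => Matrix.mem_specialUnitaryGroup_iff.2 (hUsu t)⟩
  have hA := hU.approximable (lipβ_pos hα0) (lipβ_le_one hα0) (by rwa [lipR_add_lipβ]) hN
  rw [lipR_add_lipβ] at hA
  obtain ⟨C, hC, h⟩ := hA.exists_forall_degree hα0
    (fun g hg => norm_le_one_of_mem_specialUnitaryGroup hg) hU.mem
  refine ⟨C, hC, fun n => ?_⟩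
  obtain ⟨P, hP, hPG, hUP⟩ := h n
  exact ⟨P, ⟨hP, fun t => Matrix.mem_specialUnitaryGroup_iff.1 (hPG t)⟩, hUP⟩

end SpecialUnitary

end LoopApprox

/-- For `N ≥ 2` and `α > 1/2`, every `Lip_α` loop `U : 𝕋 → SU(N)`
admits polynomial `SU(N)`-loop approximants of degree `≤ n` with error
`≤ C (n+1)^{-α/(1+α)}`. -/
theorem sun_loop_approximation_first_order (N : ℕ) (hN : 2 ≤ N) (α : ℝ) (hα : 1 / 2 < α)
    (U : ℝ → Matrix (Fin N) (Fin N) ℂ)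
    (hUper : Function.Periodic U (2 * π))
    (hUlip : MemLip α U)
    (hUsu : ∀ t : ℝ, U t ∈ SpecialUnitary N) :
    ∃ C : ℝ, 0 < C ∧ ∃ Us : ℕ → ℝ → Matrix (Fin N) (Fin N) ℂ,
      ∀ n : ℕ, IsPolyLoop n (SpecialUnitary N) (Us n) ∧
        unifNorm (fun t => U t - Us n t) ≤ C * ((n : ℝ) + 1) ^ (-(α / (1 + α))) := by
  obtain ⟨C, hC, h⟩ := LoopApprox.exists_isPolyLoop_approximation (by omega) hα
    (LoopApprox.lipClass_of_memLip hUlip hUper) hUsu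
  choose P hP hUP using h
  exact ⟨C, hC, P, fun n => ⟨hP n, ciSup_le (hUP n)⟩⟩
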